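/- Let f be a transcendental entire function. Let n be a non-negative integer, k a positive integer, and n_1,…,n_k, t_1,…,t_k positive integers such that n_j ≥ t_j for all 1 ≤ j ≤ k and n + Σ_{j=1}^k n_j ≥ 2 + Σ_{j=1}^k t_j. Then for every non-zero complex number p, the differential monomial M[f] assumes the value p infinitely often: the set {z ∈ ℂ : M[f](z) = p} is infinite. -/

import Mathlib

/-- The differential monomial `M[f](z) = f(z)^n · ∏_{j} (f^{n_j})^{(t_j)}(z)`. -/
noncomputable def diffMonomial (n k : ℕ) (nn tt : Fin k → ℕ) (f : ℂ → ℂ) : ℂ → ℂ :=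
  fun z => f z ^ n * ∏ j : Fin k, iteratedDeriv (tt j) (fun w => f w ^ nn j) z

open Complex Metric Set Filter Topology in
/-- A nonzero entire function has no zeros near, but off, any point. -/
lemma Differentiable.eventually_ne_zero_nhdsNE {f : ℂ → ℂ} (hf : Differentiable ℂ f)
    {w : ℂ} (hw : f w ≠ 0) (z : ℂ) : ∀ᶠ x in 𝓝[≠] z, f x ≠ 0 := by
  by_contra h
  have h2 : ∃ᶠ x in 𝓝[≠] z, f x = 0 := by
    simpa only [Filter.not_eventually, not_not] using h
  have hA : AnalyticOnNhd ℂ f univ := fun x _ ↦ hf.analyticAt x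
  have := hA.eqOn_zero_of_preconnected_of_frequently_eq_zero isPreconnected_univ (mem_univ z) h2
  exact hw (this (mem_univ w))

open Complex Metric Set Filter Topology in
lemma Differentiable.finite_inter_zeros {f : ℂ → ℂ} (hf : Differentiable ℂ f)
    {w : ℂ} (hw : f w ≠ 0) {K : Set ℂ} (hK : IsCompact K) : (K ∩ {z | f z = 0}).Finite := by
  have hc : IsCompact (K ∩ {z | f z = 0}) :=
    hK.inter_right (isClosed_eq hf.continuous continuous_const)
  refine hc.finite (isDiscrete_iff_nhdsNE.2 fun x hx ↦ ?_)
  rw [← disjoint_iff, Filter.disjoint_principal_right]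
  filter_upwards [hf.eventually_ne_zero_nhdsNE hw x] with y hy
  simp [hy]

open Complex Metric Set Filter Topology in
lemma Differentiable.iterate_dslope {f : ℂ → ℂ} (hf : Differentiable ℂ f) (c : ℂ) (n : ℕ) :
    Differentiable ℂ ((Function.swap dslope c)^[n] f) := by
  induction n with
  | zero => simpa
  | succ n ih =>
    rw [Function.iterate_succ_apply']
    have := (Complex.differentiableOn_dslope (c := c) (s := univ) univ_mem).2 ih.differentiableOn
    exact differentiableOn_univ.1 this

open Complex Metric Set Filter Topology in
lemma Differentiable.exists_eq_sub_pow_mul {f : ℂ → ℂ} (hf : Differentiable ℂ f)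
    {w : ℂ} (hw : f w ≠ 0) (c : ℂ) :
    ∃ (n : ℕ) (g : ℂ → ℂ), Differentiable ℂ g ∧ g c ≠ 0 ∧ ∀ z, f z = (z - c) ^ n * g z := by
  obtain ⟨p, hp⟩ := hf.analyticAt c
  have hp0 : p ≠ 0 := by
    intro h
    have h0 := hp.locally_zero_iff.2 h
    have := (h0.filter_mono nhdsWithin_le_nhds).and (hf.eventually_ne_zero_nhdsNE hw c)
    obtain ⟨x, hx⟩ := this.exists
    exact hx.2 hx.1
  exact ⟨p.order, _, hf.iterate_dslope c p.order, hp.iterate_dslope_fslope_ne_zero hp0,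
    fun z ↦ by simpa using hp.eq_pow_order_mul_iterate_dslope z⟩

open Complex Metric Set Filter Topology in
/-- An entire function with finitely many zeros in `K` is a product of linear factors times an
entire function without zeros in `K`. -/
lemma Differentiable.exists_eq_prod_mul {f : ℂ → ℂ} (hf : Differentiable ℂ f)
    {w : ℂ} (hw : f w ≠ 0) {K : Set ℂ} (hK : (K ∩ {z | f z = 0}).Finite) :
    ∃ (ι : Type) (_ : Fintype ι) (a : ι → ℂ) (g : ℂ → ℂ), Differentiable ℂ g ∧
      (∀ i, a i ∈ K) ∧ (∀ z ∈ K, g z ≠ 0) ∧ ∀ z, f z = (∏ i, (z - a i)) * g z := by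
  generalize hS : hK.toFinset = S
  induction S using Finset.induction_on generalizing f with
  | empty =>
    refine ⟨Empty, inferInstance, Empty.elim, f, hf, by simp, fun z hz hz0 ↦ ?_, by simp⟩
    have : z ∈ hK.toFinset := by simp [hz, hz0]
    simp [hS] at this
  | insert c S hc ih =>
    obtain ⟨n, g, hg, hgc, hfg⟩ := hf.exists_eq_sub_pow_mul hw c
    have hsub : K ∩ {z | g z = 0} ⊆ K ∩ {z | f z = 0} := fun z hz ↦ ⟨hz.1, by
      have := hz.2
      simp_all⟩
    have hgw : g w ≠ 0 := fun h ↦ hw (by rw [hfg, h, mul_zero])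
    have hcK : c ∈ K := by
      have : c ∈ hK.toFinset := by simp [hS]
      simp at this
      exact this.1
    have hS' : (hK.subset hsub).toFinset = S := by
      ext z
      have h1 : z ∈ hK.toFinset ↔ z ∈ insert c S := by rw [hS]
      simp only [Finite.mem_toFinset, mem_inter_iff, mem_ofPred_eq, Finset.mem_insert, hfg,
        mul_eq_zero, pow_eq_zero_iff', sub_eq_zero] at h1 ⊢
      constructor
      · rintro ⟨h2, h3⟩
        rcases h1.1 ⟨h2, Or.inr h3⟩ with rfl | h
        · exact absurd h3 hgc
        · exact h
      · intro h
        have hzc : z ≠ c := fun h' ↦ hc (h' ▸ h)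
        have := h1.2 (Or.inr h)
        tauto
    obtain ⟨ι, _, a, g', hg', ha, hg0, hgg⟩ := ih hg hgw (hK.subset hsub) hS'
    refine ⟨Fin n ⊕ ι, inferInstance, Sum.elim (fun _ ↦ c) a, g', hg', ?_, hg0, fun z ↦ ?_⟩
    · rintro (i | i)
      · exact hcK
      · exact ha i
    · simp [Fintype.prod_sum_type, hfg z, hgg z, mul_assoc]

open Complex Metric Set Filter Topology in
/-- Comparison of circle averages may ignore the zeros of an entire function. -/
lemma circleAverage_mono_of_ne_zero {G : ℂ → ℂ} (hG : Differentiable ℂ G) {w : ℂ} (hw : G w ≠ 0)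
    {r : ℝ} (hr : 0 < r) {u v : ℂ → ℝ} (hu : CircleIntegrable u 0 r) (hv : CircleIntegrable v 0 r)
    (h : ∀ z, ‖z‖ = r → G z ≠ 0 → u z ≤ v z) :
    Real.circleAverage u 0 r ≤ Real.circleAverage v 0 r := by
  classical
  have hcod : {z | G z ≠ 0} ∈ codiscreteWithin (sphere (0 : ℂ) |r|) := by
    have := AnalyticOnNhd.preimage_zero_mem_codiscrete (f := G) (fun x _ ↦ hG.analyticAt x) hw
    exact Filter.codiscreteWithin_mono (subset_univ _) this
  have heq : u =ᶠ[codiscreteWithin (sphere (0 : ℂ) |r|)] fun z ↦ if G z ≠ 0 then u z else v z := by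
    filter_upwards [hcod] with z hz
    have : G z ≠ 0 := hz
    simp [this]
  rw [Real.circleAverage_congr_codiscreteWithin heq hr.ne']
  refine Real.circleAverage_mono (hu.congr_codiscreteWithin heq) hv fun z hz ↦ ?_
  split_ifs with hz0
  · exact h z (by simpa [abs_of_pos hr] using hz) hz0
  · exact le_rfl

open Complex Metric Set Filter Topology in
lemma exists_polynomial_of_iteratedDeriv_eq_zero {f : ℂ → ℂ} (hf : Differentiable ℂ f) (k : ℕ)
    (h : ∀ n ≥ k, ∀ z, iteratedDeriv n f z = 0) : ∃ P : Polynomial ℂ, ∀ z, f z = P.eval z := by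
  refine ⟨∑ n ∈ Finset.range k, Polynomial.C ((n.factorial : ℂ)⁻¹ * iteratedDeriv n f 0) *
    Polynomial.X ^ n, fun z ↦ ?_⟩
  rw [← Complex.taylorSeries_eq_of_entire hf 0 z, tsum_eq_sum (s := Finset.range k)]
  · simp only [Polynomial.eval_finsetSum, Polynomial.eval_mul, Polynomial.eval_C,
      Polynomial.eval_pow, Polynomial.eval_X]
    refine Finset.sum_congr rfl fun n _ ↦ ?_
    simp
    ring
  · intro n hn
    rw [h n (by simpa using hn)]
    simp

open Complex Metric Set Filter Topology in
lemma exists_polynomial_of_norm_le_pow {f : ℂ → ℂ} (hf : Differentiable ℂ f) (k : ℕ) (C : ℝ)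
    (h : ∀ z, ‖f z‖ ≤ C * (1 + ‖z‖) ^ k) : ∃ P : Polynomial ℂ, ∀ z, f z = P.eval z := by
  refine exists_polynomial_of_iteratedDeriv_eq_zero hf (k + 1) fun n hn z ↦ ?_
  have hb : ∀ R : ℝ, 0 < R → ‖iteratedDeriv n f z‖ ≤
      n.factorial * (C * (1 + ‖z‖ + R) ^ k) / R ^ n := fun R hR ↦ by
    refine Complex.norm_iteratedDeriv_le_of_forall_mem_sphere_norm_le n hR hf.diffContOnCl
      fun x hx ↦ (h x).trans ?_
    have hx : ‖x‖ ≤ ‖z‖ + R := by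
      have : ‖x - z‖ = R := by simpa [dist_eq_norm] using hx
      linarith [norm_le_norm_add_norm_sub' x z]
    have hC : 0 ≤ C := by
      have := (norm_nonneg _).trans (h 0)
      simpa using this
    gcongr C * ?_ ^ k
    linarith
  have hlim : Tendsto (fun R : ℝ ↦ n.factorial * (C * (1 + ‖z‖ + R) ^ k) / R ^ n) atTop (𝓝 0) := by
    have h1 : Tendsto (fun R : ℝ ↦ (1 + ‖z‖) * R⁻¹ + 1) atTop (𝓝 ((1 + ‖z‖) * 0 + 1)) :=
      (tendsto_inv_atTop_zero.const_mul _).add_const _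
    have h2 : Tendsto (fun R : ℝ ↦ R⁻¹ ^ (n - k)) atTop (𝓝 0) := by
      have := (tendsto_inv_atTop_zero (𝕜 := ℝ)).pow (n - k)
      rwa [zero_pow (by omega)] at this
    have h3 := (((h1.pow k).mul h2).const_mul C).const_mul (n.factorial : ℝ)
    simp only [mul_zero] at h3
    refine h3.congr' ?_
    filter_upwards [eventually_gt_atTop 0] with R hR
    obtain ⟨j, rfl⟩ := Nat.exists_eq_add_of_le (show k ≤ n by omega)
    have : (1 + ‖z‖) * R⁻¹ + 1 = (1 + ‖z‖ + R) / R := by field_simp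
    rw [this, Nat.add_sub_cancel_left, div_pow, pow_add, inv_pow]
    field_simp
  have := ge_of_tendsto hlim ((eventually_gt_atTop 0).mono hb)
  simpa using le_antisymm this (norm_nonneg _)

open Complex Metric Set Filter Topology in
lemma Differentiable.iteratedDeriv_complex {f : ℂ → ℂ} (hf : Differentiable ℂ f) (n : ℕ) :
    Differentiable ℂ (iteratedDeriv n f) :=
  (hf.contDiff (n := ⊤)).differentiable_iteratedDeriv n (by exact_mod_cast WithTop.coe_lt_top _)

/-- No derivative of a positive power of a transcendental entire function vanishes identically. -/
lemma exists_iteratedDeriv_pow_ne_zero {f : ℂ → ℂ} (hf : Differentiable ℂ f)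
    (htrans : ¬ ∃ P : Polynomial ℂ, ∀ z : ℂ, f z = P.eval z) {m : ℕ} (hm : 0 < m) (t : ℕ) :
    ∃ z, iteratedDeriv t (fun w ↦ f w ^ m) z ≠ 0 := by
  by_contra! h
  have hz : iteratedDeriv t (fun w ↦ f w ^ m) = 0 := funext h
  obtain ⟨P, hP⟩ := exists_polynomial_of_iteratedDeriv_eq_zero (hf.pow m) t (fun n hn z ↦ by
    obtain ⟨j, rfl⟩ := Nat.exists_eq_add_of_le hn
    rw [add_comm, iteratedDeriv_eq_iterate, Function.iterate_add_apply,
      ← iteratedDeriv_eq_iterate (n := t)]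
    have : (fun w ↦ f w ^ m) = f ^ m := rfl
    rw [← this, hz, ← iteratedDeriv_eq_iterate]
    simp)
  refine htrans (exists_polynomial_of_norm_le_pow hf P.natDegree
    (1 + ∑ i ∈ P.support, ‖P.coeff i‖) fun z ↦ ?_)
  set S := ∑ i ∈ P.support, ‖P.coeff i‖
  have hS : 0 ≤ S := Finset.sum_nonneg fun _ _ ↦ norm_nonneg _
  have h1 : (1 : ℝ) ≤ (1 + ‖z‖) ^ P.natDegree := one_le_pow₀ (by linarith [norm_nonneg z])
  have hPz : ‖f z‖ ^ m ≤ S * (1 + ‖z‖) ^ P.natDegree := by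
    have h0 : f z ^ m = P.eval z := hP z
    rw [← norm_pow, h0, Polynomial.eval_eq_sum, Polynomial.sum, Finset.sum_mul]
    refine (norm_sum_le _ _).trans (Finset.sum_le_sum fun i hi ↦ ?_)
    rw [norm_mul, norm_pow]
    gcongr
    calc ‖z‖ ^ i ≤ (1 + ‖z‖) ^ i := by gcongr; linarith
      _ ≤ _ := pow_le_pow_right₀ (by linarith [norm_nonneg z])
          (Polynomial.le_natDegree_of_mem_supp _ hi)
  rcases le_total ‖f z‖ 1 with h2 | h2
  · nlinarith
  · have := le_self_pow₀ h2 hm.ne'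
    nlinarith

open Complex Metric Set Filter Topology in
/-- Multiplying by the Poisson kernel preserves integrability over a circle. -/
lemma CircleIntegrable.re_herglotzRieszKernel_mul {u : ℂ → ℝ} {w : ℂ} {R : ℝ}
    (hu : CircleIntegrable u 0 R) (hw : w ∈ ball (0 : ℂ) R) :
    CircleIntegrable ((re ∘ herglotzRieszKernel 0 w) * u) 0 R :=
  hu.continuousOn_mul (continuous_re.comp_continuousOn (continuousOn_herglotzRieszKernel_sphere hw))

open Complex Metric Set Filter Topology in
lemma circleAverage_poisson_log_norm {g : ℂ → ℂ} (hg : Differentiable ℂ g) {w : ℂ} {R : ℝ}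
    (h0 : ∀ z ∈ closedBall (0 : ℂ) R, g z ≠ 0) (hw : w ∈ ball (0 : ℂ) R) :
    Real.circleAverage ((re ∘ herglotzRieszKernel 0 w) * (fun z ↦ Real.log ‖g z‖)) 0 R
      = Real.log ‖g w‖ :=
  InnerProductSpace.HarmonicOnNhd.circleAverage_re_herglotzRieszKernel_smul
    (f := fun z ↦ Real.log ‖g z‖)
    (fun z hz ↦ AnalyticAt.harmonicAt_log_norm (hg.analyticAt z) (h0 z hz)) hw

open Complex Metric Set Filter Topology in
lemma norm_sq_sub_conj_mul (R : ℝ) (a z : ℂ) :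
    ‖(R : ℂ) ^ 2 - (starRingEnd ℂ) a * z‖ ^ 2 - (R * ‖z - a‖) ^ 2
      = (R ^ 2 - ‖a‖ ^ 2) * (R ^ 2 - ‖z‖ ^ 2) := by
  simp only [mul_pow, ← Complex.normSq_eq_norm_sq, Complex.normSq_apply]
  simp [pow_two]
  ring

open Complex Metric Set Filter Topology in
lemma log_norm_sub_le_circleAverage {a w : ℂ} {R : ℝ} (hw : w ∈ ball (0 : ℂ) R)
    (ha : a ∈ closedBall (0 : ℂ) R) (hwa : w ≠ a) :
    Real.log ‖w - a‖ ≤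
      Real.circleAverage ((re ∘ herglotzRieszKernel 0 w) * (fun z ↦ Real.log ‖z - a‖)) 0 R := by
  have hR : 0 < R := pos_of_mem_ball hw
  rw [mem_ball_zero_iff] at hw
  rw [mem_closedBall_zero_iff] at ha
  rcases ha.eq_or_lt with ha | ha
  · exact (circleAverage_re_herglotzRieszKernel_mul_log (by simpa using ha) (by simpa using hw)).ge
  · have hne : ∀ z ∈ closedBall (0 : ℂ) R, ((R : ℂ) ^ 2 - (starRingEnd ℂ) a * z) / R ≠ 0 := by
      intro z hz
      rw [mem_closedBall_zero_iff] at hz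
      refine div_ne_zero (fun h ↦ ?_) (by exact_mod_cast hR.ne')
      have h1 : ‖(R : ℂ) ^ 2‖ = ‖a‖ * ‖z‖ := by
        rw [sub_eq_zero.1 h]; simp
      simp only [norm_pow, Complex.norm_real, Real.norm_eq_abs, sq_abs] at h1
      nlinarith [norm_nonneg a, norm_nonneg z]
    have key := circleAverage_poisson_log_norm (w := w) (by fun_prop) hne (by simpa using hw)
    have hcong : Real.circleAverage
        ((re ∘ herglotzRieszKernel 0 w) * (fun z ↦ Real.log ‖z - a‖)) 0 R =
        Real.circleAverage ((re ∘ herglotzRieszKernel 0 w) *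
          (fun z ↦ Real.log ‖((R : ℂ) ^ 2 - (starRingEnd ℂ) a * z) / R‖)) 0 R := by
      refine Real.circleAverage_congr_sphere fun z hz ↦ ?_
      have hz : ‖z‖ = R := by simpa [abs_of_pos hR] using hz
      have h1 := norm_sq_sub_conj_mul R a z
      rw [hz] at h1
      have h2 : ‖(R : ℂ) ^ 2 - (starRingEnd ℂ) a * z‖ = R * ‖z - a‖ :=
        (sq_eq_sq₀ (norm_nonneg _) (by positivity)).1 (by linarith)
      simp only [Pi.mul_apply, norm_div, h2, Complex.norm_real, Real.norm_eq_abs, abs_of_pos hR,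
        mul_div_cancel_left₀ _ hR.ne']
    rw [hcong, key]
    refine Real.log_le_log (norm_pos_iff.2 (sub_ne_zero.2 hwa)) ?_
    have h1 := norm_sq_sub_conj_mul R a w
    have h2 : 0 ≤ (R ^ 2 - ‖a‖ ^ 2) * (R ^ 2 - ‖w‖ ^ 2) := by
      apply mul_nonneg <;> nlinarith [norm_nonneg a, norm_nonneg w]
    rw [norm_div, Complex.norm_real, Real.norm_eq_abs, abs_of_pos hR, le_div_iff₀ hR, mul_comm]
    exact (sq_le_sq₀ (by positivity) (norm_nonneg _)).1 (by linarith)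

open Complex Metric Set Filter Topology in
lemma circleIntegrable_log_norm_of_differentiable {g : ℂ → ℂ} (hg : Differentiable ℂ g) (r : ℝ) :
    CircleIntegrable (fun z ↦ Real.log ‖g z‖) 0 r :=
  MeromorphicOn.circleIntegrable_log_norm fun z _ ↦ (hg.analyticAt z).meromorphicAt

open Complex Metric Set Filter Topology in
/-- The Poisson inequality for `log ‖f‖`. -/
lemma Differentiable.log_norm_le_circleAverage {f : ℂ → ℂ} (hf : Differentiable ℂ f)
    {w : ℂ} {R : ℝ} (hw : w ∈ ball (0 : ℂ) R) (hfw : f w ≠ 0) :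
    Real.log ‖f w‖ ≤
      Real.circleAverage ((re ∘ herglotzRieszKernel 0 w) * (fun z ↦ Real.log ‖f z‖)) 0 R := by
  have hR : 0 < R := pos_of_mem_ball hw
  obtain ⟨ι, _, a, g, hg, ha, hg0, hfg⟩ :=
    hf.exists_eq_prod_mul hfw (hf.finite_inter_zeros hfw (isCompact_closedBall (0 : ℂ) R))
  have hlog : ∀ z, f z ≠ 0 →
      Real.log ‖f z‖ = ∑ i, Real.log ‖z - a i‖ + Real.log ‖g z‖ := by
    intro z hz
    rw [hfg z] at hz ⊢
    have h1 := left_ne_zero_of_mul hz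
    rw [Finset.prod_ne_zero_iff] at h1
    rw [norm_mul, norm_prod, Real.log_mul (by simpa [Finset.prod_eq_zero_iff] using h1)
      (norm_ne_zero_iff.2 (right_ne_zero_of_mul hz)),
      Real.log_prod (fun i hi ↦ norm_ne_zero_iff.2 (h1 i hi))]
  set P : ℂ → ℝ := re ∘ herglotzRieszKernel 0 w
  have hi : ∀ i, CircleIntegrable (P * (fun z ↦ Real.log ‖z - a i‖)) 0 R := fun i ↦
    (circleIntegrable_log_norm_of_differentiable (by fun_prop) R).re_herglotzRieszKernel_mul hw
  have hgi : CircleIntegrable (P * (fun z ↦ Real.log ‖g z‖)) 0 R :=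
    (circleIntegrable_log_norm_of_differentiable hg R).re_herglotzRieszKernel_mul hw
  have hsum : CircleIntegrable (fun z ↦ ∑ i, (P * (fun z ↦ Real.log ‖z - a i‖)) z) 0 R :=
    CircleIntegrable.fun_sum _ fun i _ ↦ hi i
  have h1 : Real.log ‖f w‖ ≤ Real.circleAverage (fun z ↦
      (∑ i, (P * (fun z ↦ Real.log ‖z - a i‖)) z) + (P * (fun z ↦ Real.log ‖g z‖)) z) 0 R := by
    rw [Real.circleAverage_fun_add hsum hgi, Real.circleAverage_fun_sum fun i _ ↦ hi i, hlog w hfw]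
    refine add_le_add (Finset.sum_le_sum fun i _ ↦ ?_) (circleAverage_poisson_log_norm hg hg0 hw).ge
    refine log_norm_sub_le_circleAverage hw (ha i) fun h ↦ hfw ?_
    rw [hfg w, Finset.prod_eq_zero (Finset.mem_univ i) (by simp [h]), zero_mul]
  refine h1.trans (circleAverage_mono_of_ne_zero hf hfw hR (hsum.add hgi)
    ((circleIntegrable_log_norm_of_differentiable hf R).re_herglotzRieszKernel_mul hw) ?_)
  intro z _ hz
  simp only [Pi.mul_apply, hlog z hz, mul_add, Finset.mul_sum, le_refl]

open Complex Metric Set Filter Topology in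
lemma circleIntegrable_posLog_norm_of_differentiable {g : ℂ → ℂ} (hg : Differentiable ℂ g) (r : ℝ) :
    CircleIntegrable (fun z ↦ Real.posLog ‖g z‖) 0 r :=
  MeromorphicOn.circleIntegrable_posLog_norm fun z _ ↦ (hg.analyticAt z).meromorphicAt

open Complex Metric Set Filter Topology in
lemma Differentiable.posLog_norm_le {f : ℂ → ℂ} (hf : Differentiable ℂ f)
    {w : ℂ} {R : ℝ} (hw : ‖w‖ < R) :
    Real.posLog ‖f w‖ ≤
      (R + ‖w‖) / (R - ‖w‖) * Real.circleAverage (fun z ↦ Real.posLog ‖f z‖) 0 R := by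
  have hR : 0 < R := (norm_nonneg w).trans_lt hw
  have hw' : w ∈ ball (0 : ℂ) R := by simpa using hw
  have hm : 0 ≤ Real.circleAverage (fun z ↦ Real.posLog ‖f z‖) 0 R :=
    Real.circleAverage_nonneg_of_nonneg fun z _ ↦ Real.posLog_nonneg
  have hk : 0 ≤ (R + ‖w‖) / (R - ‖w‖) := div_nonneg (by positivity) (by linarith)
  rw [Real.posLog]
  refine max_le (mul_nonneg hk hm) ?_
  by_cases hfw : f w = 0
  · simpa [hfw] using mul_nonneg hk hm
  refine (hf.log_norm_le_circleAverage hw' hfw).trans ?_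
  rw [← smul_eq_mul ((R + ‖w‖) / (R - ‖w‖)), ← Real.circleAverage_fun_smul]
  refine Real.circleAverage_mono
    ((circleIntegrable_log_norm_of_differentiable hf R).re_herglotzRieszKernel_mul hw')
    ((circleIntegrable_posLog_norm_of_differentiable hf R).const_fun_smul) ?_
  intro z hz
  have hz : z ∈ sphere (0 : ℂ) R := by simpa [abs_of_pos hR] using hz
  have hlo := le_re_herglotzRieszKernel hz hw'
  have hup := re_herglotzRieszKernel_le hz hw'
  simp only [sub_zero] at hlo hup
  have hlo' : 0 ≤ (R - ‖w‖) / (R + ‖w‖) := div_nonneg (by linarith) (by positivity)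
  simp only [Pi.mul_apply, Function.comp_apply, herglotzRieszKernel_def, sub_zero, smul_eq_mul]
  exact (mul_le_mul_of_nonneg_left (le_max_right 0 _) (hlo'.trans hlo)).trans
    (mul_le_mul_of_nonneg_right hup Real.posLog_nonneg)

/-- The quantity in which growth is measured: `R (1 + m R) / (R - r)` for radii `r < R`. -/
noncomputable def growthScale (m : ℝ → ℝ) (r R : ℝ) : ℝ := R * (1 + m R) / (R - r)

/-- An entire function whose `log⁺` is polynomially bounded in the growth scale. -/
def IsGrowthDominated (m : ℝ → ℝ) (g : ℂ → ℂ) : Prop :=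
  Differentiable ℂ g ∧ ∃ C : ℝ, 0 ≤ C ∧ ∃ K : ℕ, ∀ r R : ℝ, 1 ≤ r → r < R → ∀ z : ℂ, ‖z‖ ≤ r →
    Real.posLog ‖g z‖ ≤ C * growthScale m r R ^ K

/-- A meromorphic function whose proximity function is logarithmic in the growth scale. -/
def IsGrowthSmall (m : ℝ → ℝ) (u : ℂ → ℂ) : Prop :=
  MeromorphicOn u Set.univ ∧ ∃ C : ℝ, 0 ≤ C ∧ ∀ r R : ℝ, 1 ≤ r → r < R →
    Real.circleAverage (fun z ↦ Real.posLog ‖u z‖) 0 r ≤ C * (1 + Real.log (growthScale m r R))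

lemma one_le_growthScale {m : ℝ → ℝ} (hm : ∀ r, 0 ≤ m r) {r R : ℝ} (hr : 1 ≤ r) (hR : r < R) :
    1 ≤ growthScale m r R := by
  rw [growthScale, le_div_iff₀ (by linarith)]
  nlinarith [mul_nonneg (by linarith : (0 : ℝ) ≤ R) (hm R)]

lemma growthScale_midpoint (m : ℝ → ℝ) (r R : ℝ) :
    growthScale m ((r + R) / 2) R = 2 * growthScale m r R := by
  rw [growthScale, growthScale, show R - (r + R) / 2 = (R - r) / 2 by ring]
  rw [div_div_eq_mul_div]
  ring

namespace IsGrowthDominated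

variable {m : ℝ → ℝ} {g h : ℂ → ℂ}

lemma mul (hm : ∀ r, 0 ≤ m r) (hg : IsGrowthDominated m g) (hh : IsGrowthDominated m h) :
    IsGrowthDominated m (fun z ↦ g z * h z) := by
  obtain ⟨hg, C, hC, K, hgC⟩ := hg
  obtain ⟨hh, D, hD, L, hhD⟩ := hh
  refine ⟨hg.mul hh, C + D, by positivity, max K L, fun r R hr hR z hz ↦ ?_⟩
  have hX := one_le_growthScale hm hr hR
  rw [norm_mul, add_mul]
  refine Real.posLog_mul.trans (add_le_add ((hgC r R hr hR z hz).trans ?_)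
    ((hhD r R hr hR z hz).trans ?_))
  · exact mul_le_mul_of_nonneg_left (pow_le_pow_right₀ hX (le_max_left _ _)) hC
  · exact mul_le_mul_of_nonneg_left (pow_le_pow_right₀ hX (le_max_right _ _)) hD

lemma const (m : ℝ → ℝ) (c : ℂ) : IsGrowthDominated m (fun _ ↦ c) := by
  refine ⟨differentiable_const _, Real.posLog ‖c‖, Real.posLog_nonneg, 0, fun r R hr hR z hz ↦ ?_⟩
  simp

lemma sub (hm : ∀ r, 0 ≤ m r) (hg : IsGrowthDominated m g) (hh : IsGrowthDominated m h) :
    IsGrowthDominated m (fun z ↦ g z - h z) := by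
  obtain ⟨hg, C, hC, K, hgC⟩ := hg
  obtain ⟨hh, D, hD, L, hhD⟩ := hh
  refine ⟨hg.sub hh, Real.log 2 + C + D, by positivity, max K L, fun r R hr hR z hz ↦ ?_⟩
  have hX := one_le_growthScale hm hr hR
  have h1 : Real.log 2 ≤ Real.log 2 * growthScale m r R ^ max K L :=
    le_mul_of_one_le_right (by positivity) (one_le_pow₀ hX)
  have h2 := (hgC r R hr hR z hz).trans
    (mul_le_mul_of_nonneg_left (pow_le_pow_right₀ hX (le_max_left K L)) hC)
  have h3 := (hhD r R hr hR z hz).trans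
    (mul_le_mul_of_nonneg_left (pow_le_pow_right₀ hX (le_max_right K L)) hD)
  have h4 : Real.posLog ‖g z - h z‖ ≤ _ :=
    Real.posLog_le_posLog (norm_nonneg _) (norm_sub_le (g z) (h z))
  have h5 := Real.posLog_add (x := ‖g z‖) (y := ‖h z‖)
  linarith

lemma pow (hm : ∀ r, 0 ≤ m r) (hg : IsGrowthDominated m g) (n : ℕ) :
    IsGrowthDominated m (fun z ↦ g z ^ n) := by
  induction n with
  | zero => simpa using const m 1
  | succ n ih => simpa only [pow_succ] using mul hm ih hg

lemma prod (hm : ∀ r, 0 ≤ m r) {ι : Type*} (s : Finset ι) {u : ι → ℂ → ℂ}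
    (hu : ∀ i ∈ s, IsGrowthDominated m (u i)) :
    IsGrowthDominated m (fun z ↦ ∏ i ∈ s, u i z) := by
  classical
  induction s using Finset.induction_on with
  | empty => simpa using const m 1
  | insert a s ha ih =>
    simp only [Finset.prod_insert ha]
    exact mul hm (hu a (Finset.mem_insert_self _ _))
      (ih fun i hi ↦ hu i (Finset.mem_insert_of_mem hi))

lemma deriv (hm : ∀ r, 0 ≤ m r) (hg : IsGrowthDominated m g) :
    IsGrowthDominated m (deriv g) := by
  obtain ⟨hg, C, hC, K, hgC⟩ := hg
  refine ⟨hg.deriv, C * 2 ^ K + 2, by positivity, K + 1, fun r R hr hR z hz ↦ ?_⟩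
  have hX := one_le_growthScale hm hr hR
  set X := growthScale m r R with hXdef
  set B := C * (2 * X) ^ K with hB
  have hB0 : 0 ≤ B := by positivity
  have hδ : 0 < (R - r) / 2 := by linarith
  have h1 : ∀ y ∈ Metric.sphere z ((R - r) / 2), ‖g y‖ ≤ Real.exp B := by
    intro y hy
    have hy : ‖y‖ ≤ (r + R) / 2 := by
      have := norm_le_norm_add_norm_sub z y
      rw [mem_sphere_iff_norm, norm_sub_rev] at hy
      linarith
    have h2 := hgC ((r + R) / 2) R (by linarith) (by linarith) y hy
    rw [growthScale_midpoint] at h2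
    exact (Real.le_exp_log _).trans (Real.exp_le_exp.2 ((le_max_right _ _).trans h2))
  have h2 := Complex.norm_deriv_le_of_forall_mem_sphere_norm_le hδ hg.diffContOnCl h1
  have h3 : Real.posLog (Real.exp B) = B := by
    rw [Real.posLog, Real.log_exp, max_eq_right hB0]
  have h4 : Real.posLog ((R - r) / 2)⁻¹ ≤ 2 * X := by
    have h5 : ((R - r) / 2)⁻¹ ≤ 2 * X := by
      rw [hXdef, growthScale, inv_div, ← mul_div_assoc, div_le_div_iff_of_pos_right (by linarith)]
      nlinarith [mul_nonneg (by linarith : (0 : ℝ) ≤ R) (hm R)]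
    rw [Real.posLog]
    refine max_le (by linarith) ?_
    exact (Real.log_le_self (by positivity)).trans h5
  have h5 := Real.posLog_le_posLog (norm_nonneg _) h2
  rw [div_eq_mul_inv] at h5
  have h6 := Real.posLog_mul (x := Real.exp B) (y := ((R - r) / 2)⁻¹)
  calc Real.posLog ‖_root_.deriv g z‖ ≤ B + 2 * X := by linarith
    _ ≤ (C * 2 ^ K) * X ^ (K + 1) + 2 * X ^ (K + 1) := by
      refine add_le_add ?_ ?_
      · rw [hB, mul_pow, ← mul_assoc]
        exact mul_le_mul_of_nonneg_left (pow_le_pow_right₀ hX (by omega)) (by positivity)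
      · exact mul_le_mul_of_nonneg_left (le_self_pow₀ hX (by omega)) (by norm_num)
    _ = _ := by ring

lemma iteratedDeriv (hm : ∀ r, 0 ≤ m r) (hg : IsGrowthDominated m g) (n : ℕ) :
    IsGrowthDominated m (iteratedDeriv n g) := by
  induction n with
  | zero => simpa using hg
  | succ n ih =>
    rw [iteratedDeriv_succ]
    exact ih.deriv hm

end IsGrowthDominated

/-- The proximity function of a function `f` without poles. -/
noncomputable def entireProximity (f : ℂ → ℂ) (r : ℝ) : ℝ :=
  Real.circleAverage (fun z ↦ Real.posLog ‖f z‖) 0 r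

lemma entireProximity_nonneg (f : ℂ → ℂ) (r : ℝ) : 0 ≤ entireProximity f r :=
  Real.circleAverage_nonneg_of_nonneg fun _ _ ↦ Real.posLog_nonneg

lemma Differentiable.isGrowthDominated {f : ℂ → ℂ} (hf : Differentiable ℂ f) :
    IsGrowthDominated (entireProximity f) f := by
  refine ⟨hf, 2, by norm_num, 1, fun r R hr hR z hz ↦ ?_⟩
  refine (hf.posLog_norm_le (hz.trans_lt hR)).trans ?_
  have hm := entireProximity_nonneg f R
  change (R + ‖z‖) / (R - ‖z‖) * entireProximity f R ≤ _
  calc (R + ‖z‖) / (R - ‖z‖) * entireProximity f R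
      ≤ (2 * R) / (R - r) * (1 + entireProximity f R) := by
        refine mul_le_mul (div_le_div₀ ?_ ?_ ?_ ?_) (by linarith) hm
          (div_nonneg (by linarith) (by linarith)) <;> linarith
    _ = _ := by rw [growthScale]; ring

namespace IsGrowthSmall

variable {m : ℝ → ℝ} {u v : ℂ → ℂ}

lemma circleIntegrable (hu : IsGrowthSmall m u) (r : ℝ) :
    CircleIntegrable (fun z ↦ Real.posLog ‖u z‖) 0 r :=
  MeromorphicOn.circleIntegrable_posLog_norm fun z _ ↦ hu.1 z (Set.mem_univ z)

lemma mul (hu : IsGrowthSmall m u) (hv : IsGrowthSmall m v) :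
    IsGrowthSmall m (fun z ↦ u z * v z) := by
  have h1 := hu.circleIntegrable
  have h2 := hv.circleIntegrable
  obtain ⟨hu, C, hC, huC⟩ := hu
  obtain ⟨hv, D, hD, hvD⟩ := hv
  refine ⟨hu.mul hv, C + D, by positivity, fun r R hr hR ↦ ?_⟩
  have h3 : Real.circleAverage (fun z ↦ Real.posLog ‖u z * v z‖) 0 r ≤
      Real.circleAverage (fun z ↦ Real.posLog ‖u z‖ + Real.posLog ‖v z‖) 0 r := by
    refine Real.circleAverage_mono ?_ ((h1 r).add (h2 r)) fun z _ ↦ ?_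
    · exact MeromorphicOn.circleIntegrable_posLog_norm
        fun z _ ↦ (hu.mul hv) z (Set.mem_univ z)
    · rw [norm_mul]
      exact Real.posLog_mul
  rw [Real.circleAverage_fun_add (h1 r) (h2 r)] at h3
  have := huC r R hr hR
  have := hvD r R hr hR
  linarith

lemma const (hm : ∀ r, 0 ≤ m r) (c : ℂ) : IsGrowthSmall m (fun _ ↦ c) := by
  refine ⟨fun z _ ↦ MeromorphicAt.const c z, Real.posLog ‖c‖, Real.posLog_nonneg,
    fun r R hr hR ↦ ?_⟩
  have hX := Real.log_nonneg (one_le_growthScale hm hr hR)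
  rw [Real.circleAverage_const]
  nlinarith [Real.posLog_nonneg (x := ‖c‖)]

lemma prod (hm : ∀ r, 0 ≤ m r) {ι : Type*} (s : Finset ι) {u : ι → ℂ → ℂ}
    (hu : ∀ i ∈ s, IsGrowthSmall m (u i)) :
    IsGrowthSmall m (fun z ↦ ∏ i ∈ s, u i z) := by
  classical
  induction s using Finset.induction_on with
  | empty => simpa using const hm 1
  | insert a s ha ih =>
    simp only [Finset.prod_insert ha]
    exact mul (hu a (Finset.mem_insert_self _ _))
      (ih fun i hi ↦ hu i (Finset.mem_insert_of_mem hi))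

end IsGrowthSmall

open Complex Metric Set Filter Topology MeasureTheory in
lemma intervalIntegrable_abs_sin_rpow (a b : ℝ) :
    IntervalIntegrable (fun θ ↦ |Real.sin θ| ^ (-(1 / 2) : ℝ)) volume a b := by
  have hmeas : Measurable fun θ : ℝ ↦ |Real.sin θ| ^ (-(1 / 2) : ℝ) := by fun_prop
  have hper : Function.Periodic (fun θ ↦ |Real.sin θ| ^ (-(1 / 2) : ℝ)) Real.pi := by
    intro θ
    simp only [Real.sin_add_pi, abs_neg]
  have h1 : IntervalIntegrable (fun θ ↦ |Real.sin θ| ^ (-(1 / 2) : ℝ)) volume 0 (Real.pi / 2) := by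
    have hb : IntervalIntegrable
        (fun x : ℝ ↦ (2 / Real.pi) ^ (-(1 / 2) : ℝ) * x ^ (-(1 / 2) : ℝ)) volume 0 (Real.pi / 2) :=
      (intervalIntegral.intervalIntegrable_rpow' (by norm_num)).const_mul _
    refine hb.mono_fun hmeas.aestronglyMeasurable ?_
    refine (ae_restrict_mem measurableSet_uIoc).mono fun x hx ↦ ?_
    rw [uIoc_of_le (by positivity)] at hx
    have hpos : 0 < 2 / Real.pi * x := by have := hx.1; positivity
    have hs : 2 / Real.pi * x ≤ Real.sin x := Real.mul_le_sin hx.1.le hx.2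
    beta_reduce
    rw [← Real.mul_rpow (by positivity) hx.1.le, abs_of_pos (hpos.trans_le hs),
      Real.norm_of_nonneg (Real.rpow_nonneg (hpos.trans_le hs).le _),
      Real.norm_of_nonneg (Real.rpow_nonneg hpos.le _)]
    exact Real.rpow_le_rpow_of_nonpos hpos hs (by norm_num)
  have h2 : IntervalIntegrable (fun θ ↦ |Real.sin θ| ^ (-(1 / 2) : ℝ)) volume
      (Real.pi / 2) Real.pi := by
    have := (h1.comp_sub_left Real.pi).symm
    simp only [Real.sin_pi_sub, sub_zero] at this
    rwa [show Real.pi - Real.pi / 2 = Real.pi / 2 by ring] at this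
  exact hper.intervalIntegrable₀ Real.pi_ne_zero (h1.trans h2) a b

open Complex Metric Set Filter Topology MeasureTheory in
lemma mul_abs_sin_sub_arg_le (r : ℝ) (hr : 0 ≤ r) (a : ℂ) (θ : ℝ) :
    r * |Real.sin (θ - a.arg)| ≤ ‖circleMap 0 r θ - a‖ := by
  have h1 : circleMap 0 r θ - a = (r * cexp (↑(θ - a.arg) * I) - ‖a‖) * cexp (a.arg * I) := by
    rw [sub_mul, Complex.norm_mul_exp_arg_mul_I, mul_assoc, ← Complex.exp_add, circleMap_zero]
    congr 3
    push_cast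
    ring
  rw [h1, norm_mul, Complex.norm_exp_ofReal_mul_I, mul_one]
  refine le_trans (le_of_eq ?_) (Complex.abs_im_le_norm _)
  rw [Complex.exp_mul_I, ← Complex.ofReal_cos, ← Complex.ofReal_sin]
  rw [Complex.sub_im, Complex.im_ofReal_mul, Complex.ofReal_im, sub_zero, Complex.add_im,
    Complex.mul_I_im, Complex.ofReal_im, Complex.ofReal_re, zero_add, abs_mul, abs_of_nonneg hr]

open Complex Metric Set Filter Topology MeasureTheory in
/-- Circle averages of `‖z - a‖ ^ (-1/2)` are bounded uniformly in the pole and the radius. -/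
lemma exists_circleAverage_norm_sub_rpow_le : ∃ C : ℝ, 0 ≤ C ∧ ∀ (a : ℂ) (r : ℝ), 1 ≤ r →
    CircleIntegrable (fun z ↦ ‖z - a‖ ^ (-(1 / 2) : ℝ)) 0 r ∧
      Real.circleAverage (fun z ↦ ‖z - a‖ ^ (-(1 / 2) : ℝ)) 0 r ≤ C := by
  refine ⟨(2 * Real.pi)⁻¹ * ∫ θ in (0 : ℝ)..2 * Real.pi, |Real.sin θ| ^ (-(1 / 2) : ℝ), ?_, ?_⟩
  · exact mul_nonneg (by positivity)
      (intervalIntegral.integral_nonneg (by positivity) fun _ _ ↦ by positivity)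
  intro a r hr
  have hper : Function.Periodic (fun θ ↦ |Real.sin θ| ^ (-(1 / 2) : ℝ)) (2 * Real.pi) := by
    intro θ
    simp only [Real.sin_add_two_pi]
  have hsin : IntervalIntegrable (fun θ ↦ |Real.sin (θ - a.arg)| ^ (-(1 / 2) : ℝ)) volume
      0 (2 * Real.pi) := by
    simpa using (intervalIntegrable_abs_sin_rpow (0 - a.arg)
      (2 * Real.pi - a.arg)).comp_sub_right a.arg
  have hae : ∀ᵐ θ : ℝ, ‖circleMap 0 r θ - a‖ ^ (-(1 / 2) : ℝ) ≤
      |Real.sin (θ - a.arg)| ^ (-(1 / 2) : ℝ) := by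
    have hc : (Set.range fun n : ℤ ↦ (n : ℝ) * Real.pi + a.arg).Countable := countable_range _
    filter_upwards [hc.ae_notMem volume] with θ hθ
    have h0 : Real.sin (θ - a.arg) ≠ 0 := by
      intro h
      obtain ⟨n, hn⟩ := Real.sin_eq_zero_iff.1 h
      exact hθ ⟨n, by simp only [hn]; ring⟩
    refine Real.rpow_le_rpow_of_nonpos (abs_pos.2 h0) ?_ (by norm_num)
    have := mul_abs_sin_sub_arg_le r (by linarith) a θ
    nlinarith [abs_nonneg (Real.sin (θ - a.arg))]
  have hmeas : Measurable fun θ : ℝ ↦ ‖circleMap 0 r θ - a‖ ^ (-(1 / 2) : ℝ) := by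
    have : Measurable (circleMap 0 r) := (continuous_circleMap 0 r).measurable
    fun_prop
  have hint : IntervalIntegrable (fun θ : ℝ ↦ ‖circleMap 0 r θ - a‖ ^ (-(1 / 2) : ℝ)) volume
      0 (2 * Real.pi) := by
    refine hsin.mono_fun hmeas.aestronglyMeasurable (ae_restrict_of_ae (hae.mono fun θ hθ ↦ ?_))
    beta_reduce
    rwa [Real.norm_of_nonneg (by positivity), Real.norm_of_nonneg (by positivity)]
  refine ⟨hint, ?_⟩
  rw [Real.circleAverage, smul_eq_mul]
  refine mul_le_mul_of_nonneg_left ?_ (by positivity)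
  refine (intervalIntegral.integral_mono_ae (by positivity) hint hsin hae).trans (le_of_eq ?_)
  rw [intervalIntegral.integral_comp_sub_right
    (fun θ ↦ |Real.sin θ| ^ (-(1 / 2) : ℝ)) a.arg]
  have := hper.intervalIntegral_add_eq (0 - a.arg) 0
  rw [zero_add, show 0 - a.arg + 2 * Real.pi = 2 * Real.pi - a.arg by ring] at this
  exact this

open Complex Metric Set Filter Topology MeasureTheory in
lemma exists_circleAverage_posLog_sum_inv_le : ∃ C : ℝ, 0 ≤ C ∧
    ∀ (ι : Type) [Fintype ι] (a : ι → ℂ) (r : ℝ), 1 ≤ r →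
      Real.circleAverage (fun z ↦ Real.posLog ‖∑ i, (z - a i)⁻¹‖) 0 r ≤
        2 * Real.log (1 + Fintype.card ι * C) := by
  obtain ⟨C, hC, hav⟩ := exists_circleAverage_norm_sub_rpow_le
  refine ⟨C, hC, fun ι _ a r hr ↦ ?_⟩
  set A : ℝ := Fintype.card ι * C with hA
  have hA0 : 0 ≤ A := by positivity
  set S : ℂ → ℝ := fun z ↦ ∑ i, ‖z - a i‖ ^ (-(1 / 2) : ℝ) with hS
  have hSi : CircleIntegrable S 0 r := CircleIntegrable.fun_sum _ fun i _ ↦ (hav (a i) r hr).1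
  have hSavg : Real.circleAverage S 0 r ≤ A := by
    rw [hS, Real.circleAverage_fun_sum fun i _ ↦ (hav (a i) r hr).1]
    refine (Finset.sum_le_sum fun i _ ↦ (hav (a i) r hr).2).trans ?_
    simp [hA]
  have hpt : ∀ z, Real.posLog ‖∑ i, (z - a i)⁻¹‖ ≤
      2 * (Real.log (1 + A) - A / (1 + A)) + (2 / (1 + A)) * S z := by
    intro z
    have hS0 : 0 ≤ S z := Finset.sum_nonneg fun i _ ↦ by positivity
    have h1 : ‖∑ i, (z - a i)⁻¹‖ ≤ S z ^ 2 := by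
      refine (norm_sum_le _ _).trans (le_trans (le_of_eq (Finset.sum_congr rfl fun i _ ↦ ?_))
        (Finset.sum_sq_le_sq_sum_of_nonneg (fun i _ ↦ by positivity)))
      rw [norm_inv, ← Real.rpow_natCast, ← Real.rpow_mul (norm_nonneg _), ← Real.rpow_neg_one]
      norm_num
    have h2 := Real.posLog_le_posLog (norm_nonneg _) h1
    rw [Real.posLog_pow] at h2
    have h3 : Real.posLog (S z) ≤ Real.log (1 + S z) := by
      rw [Real.posLog]
      refine max_le (Real.log_nonneg (by linarith)) ?_
      rcases hS0.eq_or_lt with h | h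
      · rw [← h]; simp
      · exact Real.log_le_log h (by linarith)
    have h4 := Real.log_le_sub_one_of_pos (x := (1 + S z) / (1 + A)) (by positivity)
    rw [Real.log_div (by positivity) (by positivity)] at h4
    have h5 : (1 + S z) / (1 + A) - 1 = S z / (1 + A) - A / (1 + A) := by
      field_simp
      ring
    have h6 : 2 / (1 + A) * S z = 2 * (S z / (1 + A)) := by ring
    push_cast at h2
    linarith
  have hmono := Real.circleAverage_mono (c := 0) (R := r)
    (f₁ := fun z ↦ Real.posLog ‖∑ i, (z - a i)⁻¹‖)
    (f₂ := fun z ↦ 2 * (Real.log (1 + A) - A / (1 + A)) + (2 / (1 + A)) • S z)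
    (MeromorphicOn.circleIntegrable_posLog_norm fun z _ ↦
      MeromorphicAt.fun_sum fun i _ ↦ ((MeromorphicAt.id z).fun_sub (MeromorphicAt.const _ z)).fun_inv)
    ((circleIntegrable_const _ _ _).add (hSi.const_fun_smul)) (fun z _ ↦ hpt z)
  rw [Real.circleAverage_fun_add (circleIntegrable_const _ _ _) (hSi.const_fun_smul),
    Real.circleAverage_const, Real.circleAverage_fun_smul, smul_eq_mul] at hmono
  have h7 : 2 / (1 + A) * Real.circleAverage S 0 r ≤ 2 / (1 + A) * A :=
    mul_le_mul_of_nonneg_left hSavg (by positivity)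
  have h8 : 2 / (1 + A) * A = 2 * (A / (1 + A)) := by ring
  linarith

open Complex Metric Set Filter Topology in
lemma Differentiable.log_norm_zero_le_circleAverage {f : ℂ → ℂ} (hf : Differentiable ℂ f)
    {R : ℝ} (hR : 0 < R) (h0 : f 0 ≠ 0) :
    Real.log ‖f 0‖ ≤ Real.circleAverage (fun z ↦ Real.log ‖f z‖) 0 R := by
  refine (hf.log_norm_le_circleAverage (mem_ball_self hR) h0).trans (le_of_eq ?_)
  refine Real.circleAverage_congr_sphere fun z hz ↦ ?_
  have hz0 : z ≠ 0 := by
    rintro rfl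
    simp [abs_of_pos hR, hR.ne] at hz
  simp [herglotzRieszKernel_def, hz0]

open Complex Metric Set Filter Topology in
/-- A bound for the logarithmic derivative of a function without zeros, obtained from the
Borel-Carathéodory theorem. -/
lemma norm_logDeriv_le_of_log_norm_le {h : ℂ → ℂ} (hh : Differentiable ℂ h) {r δ M : ℝ}
    (hr : 0 ≤ r) (hδ : 0 < δ) (hM : 0 < M) (h0 : ∀ z ∈ closedBall (0 : ℂ) (r + 2 * δ), h z ≠ 0)
    (hle : ∀ z ∈ closedBall (0 : ℂ) (r + 2 * δ), Real.log ‖h z‖ ≤ Real.log ‖h 0‖ + M)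
    {z : ℂ} (hz : ‖z‖ ≤ r) : ‖deriv h z / h z‖ ≤ 2 * M * (r + 2 * δ) / δ / δ := by
  set R := r + 2 * δ with hRdef
  have hR : 0 < R := by positivity
  have hsub : ball (0 : ℂ) R ⊆ closedBall 0 R := ball_subset_closedBall
  have h00 : h 0 ≠ 0 := h0 0 (mem_closedBall_self hR.le)
  have hφ : DifferentiableOn ℂ (fun z ↦ deriv h z / h z) (ball 0 R) :=
    hh.deriv.differentiableOn.div hh.differentiableOn fun z hz ↦ h0 z (hsub hz)
  obtain ⟨H, hH0, hH⟩ := hφ.isExactOn_ball.with_val_at 0 0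
  have hHd : DifferentiableOn ℂ H (ball 0 R) := fun z hz ↦
    (hH z hz).differentiableAt.differentiableWithinAt
  have hexp : ∀ z ∈ ball (0 : ℂ) R, h z = h 0 * cexp (H z) := by
    intro z hz
    have hder : ∀ y ∈ ball (0 : ℂ) R, HasDerivAt (fun y ↦ h y * cexp (-H y)) 0 y := by
      intro y hy
      have h2 : h y * (deriv h y / h y) = deriv h y := mul_div_cancel₀ _ (h0 y (hsub hy))
      refine ((hh y).hasDerivAt.mul (hH y hy).neg.cexp).congr_deriv ?_
      linear_combination -cexp (-H y) * h2
    have hconst := (convex_ball (0 : ℂ) R).is_const_of_fderivWithin_eq_zero (𝕜 := ℂ)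
      (f := fun y ↦ h y * cexp (-H y))
      (fun y hy ↦ (hder y hy).differentiableAt.differentiableWithinAt)
      (fun y hy ↦ by
        rw [fderivWithin_of_isOpen isOpen_ball hy, (hder y hy).hasFDerivAt.fderiv]
        simp) hz (mem_ball_self hR)
    simp only [hH0, neg_zero, Complex.exp_zero, mul_one] at hconst
    rw [← hconst, mul_assoc, ← Complex.exp_add, neg_add_cancel, Complex.exp_zero, mul_one]
  have hre : MapsTo H (ball 0 R) {z | z.re ≤ M} := by
    intro y hy
    have h1 := hle y (hsub hy)
    rw [hexp y hy, norm_mul, Complex.norm_exp, Real.log_mul (norm_ne_zero_iff.2 h00)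
      (Real.exp_pos _).ne', Real.log_exp] at h1
    change (H y).re ≤ M
    linarith
  have hzδ : closedBall z δ ⊆ closedBall 0 (r + δ) := by
    intro y hy
    rw [mem_closedBall_iff_norm] at hy
    rw [mem_closedBall_zero_iff]
    linarith [norm_le_norm_add_norm_sub z y, norm_sub_rev z y]
  have hsub2 : closedBall (0 : ℂ) (r + δ) ⊆ ball 0 R := closedBall_subset_ball (by linarith)
  have hHle : ∀ y ∈ sphere z δ, ‖H y‖ ≤ 2 * M * R / δ := by
    intro y hy
    have hy1 := hzδ (sphere_subset_closedBall hy)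
    refine (Complex.borelCaratheodory_zero hM hHd hre hR (hsub2 hy1) hH0).trans ?_
    rw [mem_closedBall_zero_iff] at hy1
    refine div_le_div₀ (by positivity) ?_ hδ (by linarith)
    exact mul_le_mul_of_nonneg_left (by linarith) (by positivity)
  have hdc : DiffContOnCl ℂ H (ball z δ) := by
    refine (hHd.mono ?_).diffContOnCl
    rw [closure_ball z hδ.ne']
    exact hzδ.trans hsub2
  have := Complex.norm_deriv_le_of_forall_mem_sphere_norm_le hδ hdc hHle
  rwa [(hH z (hsub2 (hzδ (mem_closedBall_self hδ.le)))).deriv] at this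

open Complex Metric Set Filter Topology in
/-- Bounds for the number of zeros of an entire function in a disk, and for the factor that is left
after dividing out these zeros. -/
lemma card_zeros_and_log_norm_quotient_le {g h : ℂ → ℂ} (hh : Differentiable ℂ h) (hg0 : g 0 ≠ 0)
    {ι : Type*} [Fintype ι] {a : ι → ℂ} {R₁ R₂ B : ℝ} (hR₁ : 0 < R₁) (hR₂ : R₁ < R₂)
    (hB : ∀ z, ‖z‖ ≤ R₂ → Real.posLog ‖g z‖ ≤ B) (ha : ∀ i, a i ∈ closedBall (0 : ℂ) R₁)
    (hgh : ∀ z, g z = (∏ i, (z - a i)) * h z) :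
    Fintype.card ι * ((R₂ - R₁) / R₂) ≤ B + |Real.log ‖g 0‖| ∧
    ∀ z ∈ closedBall (0 : ℂ) R₁, h z ≠ 0 → Real.log ‖h z‖ ≤
      Real.log ‖h 0‖ + (B + |Real.log ‖g 0‖| + Fintype.card ι * (R₁ / (R₂ - R₁))) := by
  have hR₂0 : 0 < R₂ := hR₁.trans hR₂
  have hB0 : 0 ≤ B := Real.posLog_nonneg.trans (hB 0 (by simpa using hR₂0.le))
  have hg0' := hg0
  rw [hgh 0] at hg0'
  have hh0 : h 0 ≠ 0 := right_ne_zero_of_mul hg0'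
  have ha0 : ∀ i, a i ≠ 0 := by
    intro i
    have := Finset.prod_ne_zero_iff.1 (left_ne_zero_of_mul hg0') i (Finset.mem_univ i)
    simpa using this
  have ha1 : ∀ i, ‖a i‖ ≤ R₁ := fun i ↦ by simpa using ha i
  have hlog0 : Real.log ‖g 0‖ = ∑ i, Real.log ‖a i‖ + Real.log ‖h 0‖ := by
    rw [hgh 0, norm_mul, norm_prod, Real.log_mul (by simpa [Finset.prod_eq_zero_iff] using ha0)
      (norm_ne_zero_iff.2 hh0), Real.log_prod (fun i _ ↦ by simpa using ha0 i)]
    simp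
  have hlogle : Real.log ‖g 0‖ ≤ Fintype.card ι * Real.log R₁ + Real.log ‖h 0‖ := by
    rw [hlog0]
    refine add_le_add_left ((Finset.sum_le_sum fun i _ ↦
      Real.log_le_log (norm_pos_iff.2 (ha0 i)) (ha1 i)).trans (by simp)) _
  have hneg := neg_abs_le (Real.log ‖g 0‖)
  constructor
  · have h1 := hh.log_norm_zero_le_circleAverage hR₂0 hh0
    have hi : ∀ i, CircleIntegrable (fun z ↦ Real.log ‖z - a i‖) 0 R₂ := fun i ↦
      circleIntegrable_log_norm_of_differentiable (by fun_prop) R₂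
    have hsi : CircleIntegrable (fun z ↦ ∑ i, Real.log ‖z - a i‖) 0 R₂ :=
      CircleIntegrable.fun_sum _ fun i _ ↦ hi i
    have hhi := circleIntegrable_log_norm_of_differentiable hh R₂
    have h2 : Real.circleAverage (fun z ↦ ∑ i, Real.log ‖z - a i‖ + Real.log ‖h z‖) 0 R₂ ≤ B := by
      refine (circleAverage_mono_of_ne_zero hh hh0 hR₂0 (hsi.add hhi)
        (circleIntegrable_const B _ _) fun z hz hhz ↦ ?_).trans_eq (Real.circleAverage_const _ _ _)
      have hza : ∀ i, z - a i ≠ 0 := by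
        intro i h
        have := ha1 i
        rw [← sub_eq_zero.1 h] at this
        linarith
      have h3 := (le_max_right 0 _).trans (hB z hz.le)
      rwa [hgh z, norm_mul, norm_prod, Real.log_mul
        (Finset.prod_ne_zero_iff.2 fun i _ ↦ norm_ne_zero_iff.2 (hza i)) (norm_ne_zero_iff.2 hhz),
        Real.log_prod (fun i _ ↦ norm_ne_zero_iff.2 (hza i))] at h3
    rw [Real.circleAverage_fun_add hsi hhi, Real.circleAverage_fun_sum fun i _ ↦ hi i] at h2
    have h4 : ∀ i, Real.circleAverage (fun z ↦ Real.log ‖z - a i‖) 0 R₂ = Real.log R₂ := fun i ↦ by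
      refine circleAverage_log_norm_sub_const_of_mem_closedBall ?_
      rw [abs_of_pos hR₂0]
      exact closedBall_subset_closedBall hR₂.le (ha i)
    simp only [h4, Finset.sum_const, Finset.card_univ, nsmul_eq_mul] at h2
    have h5 : (R₂ - R₁) / R₂ ≤ Real.log R₂ - Real.log R₁ := by
      rw [← Real.log_div hR₂0.ne' hR₁.ne']
      have := Real.one_sub_inv_le_log_of_pos (x := R₂ / R₁) (by positivity)
      rwa [inv_div, one_sub_div hR₂0.ne'] at this
    have h6 := mul_le_mul_of_nonneg_left h5 (Nat.cast_nonneg (α := ℝ) (Fintype.card ι))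
    linarith
  · intro z hz hhz
    set q := R₂ - R₁ with hq
    have hq0 : 0 < q := by linarith
    set N := Fintype.card ι
    have hbd : ‖h z‖ ≤ Real.exp B / q ^ N := by
      refine Complex.norm_le_of_forall_mem_frontier_norm_le (U := ball (0 : ℂ) R₂) isBounded_ball
        hh.diffContOnCl (fun y hy ↦ ?_) (subset_closure (closedBall_subset_ball hR₂ hz))
      rw [frontier_ball _ hR₂0.ne', mem_sphere_zero_iff_norm] at hy
      have h3 : ‖g y‖ ≤ Real.exp B :=
        (Real.le_exp_log _).trans (Real.exp_le_exp.2 ((le_max_right 0 _).trans (hB y hy.le)))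
      rw [le_div_iff₀ (by positivity), mul_comm]
      refine le_trans ?_ h3
      rw [hgh y, norm_mul, norm_prod]
      refine mul_le_mul_of_nonneg_right ?_ (norm_nonneg _)
      rw [show q ^ N = ∏ _i : ι, q by simp [N]]
      refine Finset.prod_le_prod (fun _ _ ↦ hq0.le) fun i _ ↦ ?_
      have := norm_sub_norm_le y (a i)
      have := ha1 i
      linarith
    have h1 := Real.log_le_log (norm_pos_iff.2 hhz) hbd
    rw [Real.log_div (Real.exp_pos _).ne' (by positivity), Real.log_exp, Real.log_pow] at h1
    have h5 : Real.log R₁ - Real.log q ≤ R₁ / q := by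
      rw [← Real.log_div hR₁.ne' hq0.ne']
      exact Real.log_le_self (by positivity)
    have h6 := mul_le_mul_of_nonneg_left h5 (Nat.cast_nonneg (α := ℝ) N)
    linarith

lemma Real.posLog_le_log_of_le {x y : ℝ} (hx : 0 ≤ x) (hxy : x ≤ y) (hy : 1 ≤ y) :
    Real.posLog x ≤ Real.log y := by
  rw [← Real.posLog_eq_log (by rwa [abs_of_nonneg (by linarith)])]
  exact Real.posLog_le_posLog hx hxy

lemma div_deriv_eq_sum_inv_add {g h : ℂ → ℂ} (hh : Differentiable ℂ h) {ι : Type*} [Fintype ι]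
    {a : ι → ℂ} (hgh : ∀ z, g z = (∏ i, (z - a i)) * h z) {z : ℂ}
    (hza : ∀ i ∈ Finset.univ, z - a i ≠ 0) (hhz : h z ≠ 0) :
    deriv g z / g z = ∑ i, (z - a i)⁻¹ + deriv h z / h z := by
  have h2 := logDeriv_mul (f := fun z ↦ ∏ i, (z - a i)) z (Finset.prod_ne_zero_iff.2 hza) hhz
    (by fun_prop) (hh z)
  have h3 := logDeriv_prod (s := Finset.univ) (f := fun i z ↦ z - a i) (x := z) hza
    (fun i _ ↦ by fun_prop)
  have h4 : g = fun z ↦ (∏ i, (z - a i)) * h z := funext hgh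
  rw [← logDeriv_apply, ← logDeriv_apply, h4, h2, h3]
  congr 1
  refine Finset.sum_congr rfl fun i _ ↦ ?_
  simp [logDeriv_apply]

set_option maxHeartbeats 1000000 in
open Complex Metric Set Filter Topology in
/-- The lemma on the logarithmic derivative. -/
lemma isGrowthSmall_logDeriv {m : ℝ → ℝ} (hm : ∀ r, 0 ≤ m r) {g : ℂ → ℂ}
    (hg : IsGrowthDominated m g) (hg0 : g 0 ≠ 0) :
    IsGrowthSmall m (fun z ↦ deriv g z / g z) := by
  obtain ⟨hg, C, hC, K, hgC⟩ := hg
  obtain ⟨C₀, hC₀, hav⟩ := exists_circleAverage_posLog_sum_inv_le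
  set E : ℝ := C + |Real.log ‖g 0‖| + 1 with hE
  have hE1 : 1 ≤ E := by have := abs_nonneg (Real.log ‖g 0‖); linarith
  have hmer : MeromorphicOn (fun z ↦ deriv g z / g z) univ := fun z _ ↦
    (hg.deriv.analyticAt z).meromorphicAt.fun_div (hg.analyticAt z).meromorphicAt
  set α : ℝ := Real.log 2 + 2 * Real.log (1 + E * C₀) + Real.log (4 * E) with hα
  have hα0 : 0 ≤ α := by
    have h1 : 0 ≤ Real.log (1 + E * C₀) := Real.log_nonneg (by nlinarith)
    have h2 : 0 ≤ Real.log (4 * E) := Real.log_nonneg (by linarith)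
    positivity
  set β : ℝ := 2 * (K + 1) + (K + 4) with hβ
  have hβ0 : 0 ≤ β := by positivity
  refine ⟨hmer, α + β * Real.log 4 + β, by positivity, fun r R hr hR ↦ ?_⟩
  have hX := one_le_growthScale hm hr hR
  set X := growthScale m r R with hXdef
  set δ : ℝ := (R - r) / 4 with hδdef
  have hδ : 0 < δ := by rw [hδdef]; linarith
  have hR4 : R = r + 4 * δ := by rw [hδdef]; ring
  set Y : ℝ := 4 * X with hYdef
  have hY : 1 ≤ Y := by linarith
  have hYm : Y = R * (1 + m R) / δ := by
    rw [hYdef, hXdef, growthScale, show R - r = 4 * δ by linarith]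
    field_simp
  have hRY : R / δ ≤ Y := by
    rw [hYm, div_le_div_iff_of_pos_right hδ]
    nlinarith [mul_nonneg (by linarith : (0 : ℝ) ≤ R) (hm R)]
  have hY2 : growthScale m (r + 3 * δ) R = Y := by
    rw [hYm, growthScale, show R - (r + 3 * δ) = δ by linarith]
  obtain ⟨ι, _, a, h, hh, ha, hh0, hgh⟩ := hg.exists_eq_prod_mul hg0
    (hg.finite_inter_zeros hg0 (isCompact_closedBall (0 : ℂ) (r + 2 * δ)))
  set N : ℝ := (Fintype.card ι : ℝ) with hN
  have hN0 : 0 ≤ N := Nat.cast_nonneg _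
  have hB : ∀ z : ℂ, ‖z‖ ≤ r + 3 * δ → Real.posLog ‖g z‖ ≤ C * Y ^ K := by
    intro z hz
    have := hgC (r + 3 * δ) R (by linarith) (by linarith) z hz
    rwa [hY2] at this
  obtain ⟨hcard, hlog⟩ := card_zeros_and_log_norm_quotient_le hh hg0
    (R₁ := r + 2 * δ) (by linarith) (by linarith) hB ha hgh
  rw [show r + 3 * δ - (r + 2 * δ) = δ by ring] at hcard hlog
  set b : ℝ := C * Y ^ K + |Real.log ‖g 0‖| with hb
  have hb0 : 0 ≤ b := by positivity
  have hbE : b + 1 ≤ E * Y ^ K := by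
    have h1 := one_le_pow₀ hY (n := K)
    have h2 := le_mul_of_one_le_right (abs_nonneg (Real.log ‖g 0‖)) h1
    rw [hE, hb, add_mul, add_mul]
    linarith
  have hNle : N ≤ b * Y := by
    have h1 : N ≤ b * ((r + 3 * δ) / δ) := by
      have hρ : 0 < r + 3 * δ := by linarith
      have h2 := mul_le_mul_of_nonneg_right hcard (div_nonneg hρ.le hδ.le)
      rwa [mul_assoc, div_mul_div_cancel₀ hρ.ne', div_self hδ.ne', mul_one] at h2
    refine h1.trans (mul_le_mul_of_nonneg_left (le_trans ?_ hRY) hb0)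
    rw [div_le_div_iff_of_pos_right hδ]
    linarith
  have hR₁Y : (r + 2 * δ) / δ ≤ Y := le_trans (by
    rw [div_le_div_iff_of_pos_right hδ]
    linarith) hRY
  set M : ℝ := b + N * ((r + 2 * δ) / δ) + 1 with hMdef
  have hM : 0 < M := by positivity
  have hMle : M ≤ 2 * E * Y ^ (K + 2) := by
    have h1 : N * ((r + 2 * δ) / δ) ≤ b * Y * Y := mul_le_mul hNle hR₁Y (by positivity) (by positivity)
    have h2 : b * Y * Y ≤ E * Y ^ K * Y * Y := by gcongr; linarith
    have h3 : E * Y ^ K ≤ E * Y ^ (K + 2) := by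
      gcongr
      omega
    have h4 : E * Y ^ K * Y * Y = E * Y ^ (K + 2) := by ring
    linarith
  have hinv : 1 / δ ≤ Y := le_trans (by
    rw [div_le_div_iff_of_pos_right hδ]
    linarith) hRY
  have hquot : ∀ z : ℂ, ‖z‖ ≤ r → Real.posLog ‖deriv h z / h z‖ ≤
      Real.log (4 * E) + (K + 4) * Real.log Y := by
    intro z hz
    have h1 := norm_logDeriv_le_of_log_norm_le hh (by linarith) hδ hM hh0
      (fun y hy ↦ (hlog y hy (hh0 y hy)).trans (by rw [hMdef]; linarith)) hz
    have h2 : 2 * M * (r + 2 * δ) / δ / δ ≤ 4 * E * Y ^ (K + 4) := by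
      calc 2 * M * (r + 2 * δ) / δ / δ = 2 * M * ((r + 2 * δ) / δ) * (1 / δ) := by field_simp
        _ ≤ 2 * (2 * E * Y ^ (K + 2)) * Y * Y := by gcongr
        _ = 4 * E * Y ^ (K + 4) := by ring
    refine (Real.posLog_le_log_of_le (norm_nonneg _) (h1.trans h2) ?_).trans (le_of_eq ?_)
    · have := one_le_pow₀ hY (n := K + 4)
      nlinarith
    · rw [Real.log_mul (by positivity) (by positivity), Real.log_pow]
      push_cast
      ring
  have hsum : 2 * Real.log (1 + N * C₀) ≤ 2 * Real.log (1 + E * C₀) + 2 * (K + 1) * Real.log Y := by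
    have h1 : 1 + N * C₀ ≤ (1 + E * C₀) * Y ^ (K + 1) := by
      have h2 : N ≤ E * Y ^ (K + 1) := by
        calc N ≤ b * Y := hNle
          _ ≤ E * Y ^ K * Y := by gcongr; linarith
          _ = _ := by ring
      have h3 := one_le_pow₀ hY (n := K + 1)
      nlinarith [mul_le_mul_of_nonneg_right h2 hC₀]
    have h2 := Real.log_le_log (by positivity) h1
    rw [Real.log_mul (by positivity) (by positivity), Real.log_pow] at h2
    push_cast at h2
    linarith
  have hSi : CircleIntegrable (fun z ↦ Real.posLog ‖∑ i, (z - a i)⁻¹‖) 0 r :=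
    MeromorphicOn.circleIntegrable_posLog_norm fun z _ ↦
      MeromorphicAt.fun_sum fun i _ ↦ ((MeromorphicAt.id z).fun_sub (MeromorphicAt.const _ z)).fun_inv
  set Q : ℝ := Real.log 2 + (Real.log (4 * E) + (K + 4) * Real.log Y) with hQ
  have hmono := circleAverage_mono_of_ne_zero hg hg0 (by linarith : 0 < r)
    (u := fun z ↦ Real.posLog ‖deriv g z / g z‖)
    (v := fun z ↦ Real.posLog ‖∑ i, (z - a i)⁻¹‖ + Q)
    (MeromorphicOn.circleIntegrable_posLog_norm fun z _ ↦ hmer z (mem_univ z))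
    (hSi.add (circleIntegrable_const _ _ _)) (by
      intro z hz hgz
      rw [hgh z] at hgz
      have hza := Finset.prod_ne_zero_iff.1 (left_ne_zero_of_mul hgz)
      have hhz := right_ne_zero_of_mul hgz
      have h1 : deriv g z / g z = ∑ i, (z - a i)⁻¹ + deriv h z / h z :=
        div_deriv_eq_sum_inv_add hh hgh hza hhz
      have h2 : Real.posLog ‖∑ i, (z - a i)⁻¹ + deriv h z / h z‖ ≤ _ :=
        Real.posLog_le_posLog (norm_nonneg _) (norm_add_le _ _)
      have h3 := Real.posLog_add (x := ‖∑ i, (z - a i)⁻¹‖) (y := ‖deriv h z / h z‖)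
      have h4 := hquot z hz.le
      rw [h1, hQ]
      linarith)
  rw [Real.circleAverage_fun_add hSi (circleIntegrable_const _ _ _),
    Real.circleAverage_const] at hmono
  have h1 := hav ι a r hr
  have hXl : 0 ≤ Real.log X := Real.log_nonneg hX
  have hYl : Real.log Y = Real.log 4 + Real.log X := by
    rw [hYdef, Real.log_mul (by norm_num) (by positivity)]
  have h2 : Real.circleAverage (fun z ↦ Real.posLog ‖deriv g z / g z‖) 0 r ≤ α + β * Real.log Y := by
    rw [hα, hβ]
    linarith
  refine h2.trans ?_
  rw [hYl]
  have h3 : 0 ≤ (α + β * Real.log 4) * Real.log X := by positivity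
  nlinarith

lemma exists_iteratedDeriv_pow_eq {f : ℂ → ℂ} (hf : Differentiable ℂ f) {t k : ℕ} (htk : t ≤ k) :
    ∃ q : ℂ → ℂ, Differentiable ℂ q ∧
      ∀ z, iteratedDeriv t (fun w ↦ f w ^ k) z = f z ^ (k - t) * q z := by
  induction t with
  | zero => exact ⟨fun _ ↦ 1, differentiable_const _, fun z ↦ by simp⟩
  | succ t ih =>
    obtain ⟨q, hq, h⟩ := ih (by omega)
    obtain ⟨s, hs⟩ : ∃ s, k - t = s + 1 := ⟨k - t - 1, by omega⟩
    have hs' : k - (t + 1) = s := by omega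
    refine ⟨fun z ↦ (s + 1) * deriv f z * q z + f z * deriv q z, ?_, fun z ↦ ?_⟩
    · have := hf.deriv
      have := hq.deriv
      fun_prop
    · rw [iteratedDeriv_succ, funext h, hs, hs',
        (((hf z).hasDerivAt.fun_pow (s + 1)).fun_mul (hq z).hasDerivAt).deriv]
      simp only [Nat.add_sub_cancel]
      push_cast
      ring

open Set in
lemma IsGrowthSmall.congr_of_ne_zero {m : ℝ → ℝ} {u v G : ℂ → ℂ} (hv : IsGrowthSmall m v)
    (hu : MeromorphicOn u univ) (hG : Differentiable ℂ G) (hG0 : G 0 ≠ 0)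
    (huv : ∀ z, G z ≠ 0 → u z = v z) : IsGrowthSmall m u := by
  have hvi := hv.circleIntegrable
  obtain ⟨_, C, hC, hvC⟩ := hv
  refine ⟨hu, C, hC, fun r R hr hR ↦ le_trans ?_ (hvC r R hr hR)⟩
  refine circleAverage_mono_of_ne_zero hG hG0 (by linarith)
    (MeromorphicOn.circleIntegrable_posLog_norm fun z _ ↦ hu z (mem_univ z)) (hvi r)
    fun z _ hz ↦ ?_
  rw [huv z hz]

open Set in
lemma isGrowthSmall_iteratedDeriv_div {m : ℝ → ℝ} (hm : ∀ r, 0 ≤ m r) {g : ℂ → ℂ}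
    (hg : IsGrowthDominated m g) {t : ℕ} (h0 : ∀ i ≤ t, iteratedDeriv i g 0 ≠ 0) :
    IsGrowthSmall m (fun z ↦ iteratedDeriv t g z / g z) := by
  have hd := fun i ↦ hg.1.iteratedDeriv_complex i
  induction t with
  | zero =>
    refine (IsGrowthSmall.const hm 1).congr_of_ne_zero ?_ hg.1 (by simpa using h0 0 le_rfl) ?_
    · exact fun z _ ↦ ((hd 0).analyticAt z).meromorphicAt.fun_div (hg.1.analyticAt z).meromorphicAt
    · intro z hz
      simp [hz]
  | succ t ih =>
    refine ((isGrowthSmall_logDeriv hm (hg.iteratedDeriv hm t) (h0 t (by omega))).mul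
      (ih fun i hi ↦ h0 i (by omega))).congr_of_ne_zero ?_ (hd t) (h0 t (by omega)) ?_
    · exact fun z _ ↦
        ((hd (t + 1)).analyticAt z).meromorphicAt.fun_div (hg.1.analyticAt z).meromorphicAt
    · intro z hz
      rw [iteratedDeriv_succ, div_mul_div_cancel₀ hz]

lemma circleAverage_log_norm_of_forall_ne_zero {g : ℂ → ℂ} (hg : Differentiable ℂ g)
    (h0 : ∀ z, g z ≠ 0) {r : ℝ} (hr : 0 < r) :
    Real.circleAverage (fun z ↦ Real.log ‖g z‖) 0 r = Real.log ‖g 0‖ := by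
  rw [← circleAverage_poisson_log_norm hg (fun z _ ↦ h0 z) (Metric.mem_ball_self hr)]
  refine (Real.circleAverage_congr_sphere fun z hz ↦ ?_).symm
  have hz0 : z ≠ 0 := by
    rintro rfl
    simp [abs_of_pos hr, hr.ne] at hz
  simp [herglotzRieszKernel_def, hz0]

/-- An entire function with finitely many zeros has only logarithmically growing mean of
`log ‖F‖`. -/
lemma exists_circleAverage_log_norm_le {F : ℂ → ℂ} (hF : Differentiable ℂ F) {w : ℂ} (hw : F w ≠ 0)
    (hfin : {z | F z = 0}.Finite) : ∃ C : ℝ, 0 ≤ C ∧ ∀ r : ℝ, 1 ≤ r →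
      Real.circleAverage (fun z ↦ Real.log ‖F z‖) 0 r ≤ C * (1 + Real.log r) := by
  obtain ⟨ι, _, a, g, hg, -, hg0, hFg⟩ := hF.exists_eq_prod_mul hw (K := Set.univ)
    (by simpa using hfin)
  have hg0 : ∀ z, g z ≠ 0 := fun z ↦ hg0 z (Set.mem_univ z)
  set S : ℝ := ∑ i, Real.log (1 + ‖a i‖) with hS
  have hS0 : 0 ≤ S := Finset.sum_nonneg fun i _ ↦ Real.log_nonneg (by linarith [norm_nonneg (a i)])
  refine ⟨S + |Real.log ‖g 0‖| + Fintype.card ι, by positivity, fun r hr ↦ ?_⟩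
  have hr0 : 0 < r := by linarith
  have hlr : 0 ≤ Real.log r := Real.log_nonneg hr
  have hi := circleIntegrable_log_norm_of_differentiable hg r
  have hmono := circleAverage_mono_of_ne_zero hF hw hr0
    (circleIntegrable_log_norm_of_differentiable hF r)
    ((circleIntegrable_const (S + Fintype.card ι * Real.log r) 0 r).add hi) (fun z hz hFz ↦ by
      rw [hFg z] at hFz ⊢
      have h1 := Finset.prod_ne_zero_iff.1 (left_ne_zero_of_mul hFz)
      rw [norm_mul, norm_prod, Real.log_mul
        (Finset.prod_ne_zero_iff.2 fun i hi ↦ norm_ne_zero_iff.2 (h1 i hi))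
        (norm_ne_zero_iff.2 (hg0 z)), Real.log_prod (fun i hi ↦ norm_ne_zero_iff.2 (h1 i hi))]
      have h2 : ∑ i, Real.log ‖z - a i‖ ≤ ∑ i, (Real.log (1 + ‖a i‖) + Real.log r) := by
        refine Finset.sum_le_sum fun i hi ↦ ?_
        rw [← Real.log_mul (by positivity) hr0.ne']
        refine Real.log_le_log (norm_pos_iff.2 (h1 i hi)) ((norm_sub_le _ _).trans ?_)
        rw [hz]
        nlinarith [norm_nonneg (a i)]
      rw [Finset.sum_add_distrib] at h2
      simp only [Finset.sum_const, Finset.card_univ, nsmul_eq_mul] at h2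
      exact add_le_add_left h2 _)
  have h3 : Real.circleAverage ((fun _ ↦ S + Fintype.card ι * Real.log r) +
      fun z ↦ Real.log ‖g z‖) 0 r = S + Fintype.card ι * Real.log r + Real.log ‖g 0‖ := by
    rw [Real.circleAverage_add (circleIntegrable_const _ 0 r) hi, Real.circleAverage_const,
      circleAverage_log_norm_of_forall_ne_zero hg hg0 hr0]
  refine (hmono.trans_eq h3).trans ?_
  have := le_abs_self (Real.log ‖g 0‖)
  have : 0 ≤ (S + |Real.log ‖g 0‖|) * Real.log r := by positivity
  have : (0 : ℝ) ≤ Fintype.card ι := by positivity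
  nlinarith

lemma mul_posLog_eq (d : ℕ) (x : ℝ) :
    d * Real.posLog x = Real.posLog (x⁻¹ ^ d) + d * Real.log x := by
  rw [Real.posLog_pow, ← Real.posLog_sub_posLog_inv]
  ring

open Set in
/-- If `M = f ^ e * Q` and `M' / M`, `M / f ^ d` and the logarithmic derivative of `M - p` are small,
where `M - p` has only finitely many zeros, then `f` grows slowly. -/
lemma entireProximity_le_of_finite {f M Q : ℂ → ℂ} (hf : Differentiable ℂ f)
    (hQ : Differentiable ℂ Q) {d e : ℕ} (he : 2 ≤ e) (hed : e ≤ d) {p : ℂ} (hp : p ≠ 0)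
    (hM : IsGrowthDominated (entireProximity f) M) (hMQ : ∀ z, M z = f z ^ e * Q z)
    (hf0 : f 0 ≠ 0) (hM0 : M 0 ≠ 0) (hMp : M 0 - p ≠ 0) (hM' : deriv M 0 ≠ 0)
    (hA : IsGrowthSmall (entireProximity f) (fun z ↦ M z / f z ^ d))
    (hfin : {z | M z = p}.Finite) :
    ∃ C : ℝ, 0 ≤ C ∧ ∀ r R : ℝ, 1 ≤ r → r < R → entireProximity f r ≤
      C * (1 + Real.log R + Real.log (growthScale (entireProximity f) r R)) := by
  have hm := entireProximity_nonneg f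
  have hF : IsGrowthDominated (entireProximity f) (fun z ↦ M z - p) :=
    hM.sub hm (IsGrowthDominated.const _ p)
  have hdF : ∀ z, deriv (fun z ↦ M z - p) z = deriv M z := fun z ↦ deriv_sub_const p
  have hL := isGrowthSmall_logDeriv hm hM hM0
  have hT := isGrowthSmall_logDeriv hm hF hMp
  simp only [hdF] at hT
  obtain ⟨s, rfl⟩ : ∃ s, e = s + 2 := ⟨e - 2, by omega⟩
  set H : ℂ → ℂ := fun z ↦ (s + 2) * deriv f z * Q z + f z * deriv Q z with hHdef
  have hH : Differentiable ℂ H := by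
    have := hf.deriv
    have := hQ.deriv
    fun_prop
  have hMH : ∀ z, deriv M z = f z ^ (s + 1) * H z := by
    intro z
    rw [funext hMQ, (((hf z).hasDerivAt.fun_pow (s + 2)).fun_mul (hQ z).hasDerivAt).deriv]
    simp only [hHdef, show s + 2 - 1 = s + 1 by omega]
    push_cast
    ring
  have hH0 : H 0 ≠ 0 := by
    have := hM'
    rw [hMH 0] at this
    exact right_ne_zero_of_mul this
  obtain ⟨CF, hCF, hFle⟩ := exists_circleAverage_log_norm_le hF.1 hMp
    (by simpa only [sub_eq_zero] using hfin)
  have hAi := hA.circleIntegrable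
  have hLi := hL.circleIntegrable
  have hTi := hT.circleIntegrable
  obtain ⟨-, CA, hCA, hAle⟩ := hA
  obtain ⟨-, CL, hCL, hLle⟩ := hL
  obtain ⟨-, CT, hCT, hTle⟩ := hT
  set c : ℝ := Real.posLog ‖p⁻¹‖ + Real.log 2 + |Real.log ‖H 0‖| with hc
  have hc0 : 0 ≤ c := by
    have := Real.posLog_nonneg (x := ‖p⁻¹‖)
    positivity
  refine ⟨c + 2 * CA + CL + CT + CF, by positivity, fun r R hr hR ↦ ?_⟩
  have hr0 : 0 < r := by linarith
  set X := growthScale (entireProximity f) r R with hX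
  have hfi := circleIntegrable_log_norm_of_differentiable hf r
  have hHi := circleIntegrable_log_norm_of_differentiable hH r
  have hFi := circleIntegrable_log_norm_of_differentiable hF.1 r
  have hfi' := circleIntegrable_posLog_norm_of_differentiable hf r
  have hpt : ∀ z, f z ≠ 0 → M z ≠ 0 → deriv M z ≠ 0 → M z - p ≠ 0 →
      (s + 1) * Real.posLog ‖f z‖ ≤ Real.posLog ‖p⁻¹‖ + Real.log 2 +
        2 * Real.posLog ‖M z / f z ^ d‖ + Real.posLog ‖deriv M z / M z‖ +
        Real.posLog ‖deriv M z / (M z - p)‖ + Real.log ‖M z - p‖ - Real.log ‖H z‖ +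
        (d - (s + 1)) * (Real.log ‖f z‖ - Real.posLog ‖f z‖) := by
    intro z hfz hMz hM'z hFz
    have hHz : H z ≠ 0 := by
      rw [hMH z] at hM'z
      exact right_ne_zero_of_mul hM'z
    have h1 := mul_posLog_eq d ‖f z‖
    have h2 : ‖f z‖⁻¹ ^ d = ‖p⁻¹‖ * ‖M z / f z ^ d -
        deriv M z / M z * ((M z / f z ^ d) * ((M z - p) / deriv M z))‖ := by
      rw [← norm_mul, ← norm_inv, ← norm_pow]
      congr 1
      rw [inv_pow]
      field_simp
      ring
    have h3 := Real.posLog_mul (x := ‖p⁻¹‖) (y := ‖M z / f z ^ d -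
        deriv M z / M z * ((M z / f z ^ d) * ((M z - p) / deriv M z))‖)
    have h4 := (Real.posLog_le_posLog (norm_nonneg _) (norm_sub_le (M z / f z ^ d)
      (deriv M z / M z * ((M z / f z ^ d) * ((M z - p) / deriv M z))))).trans Real.posLog_add
    rw [norm_mul (deriv M z / M z), norm_mul (M z / f z ^ d)] at h4
    have h5 := Real.posLog_mul (x := ‖deriv M z / M z‖)
      (y := ‖M z / f z ^ d‖ * ‖(M z - p) / deriv M z‖)
    have h6 := Real.posLog_mul (x := ‖M z / f z ^ d‖) (y := ‖(M z - p) / deriv M z‖)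
    have h7 := Real.posLog_sub_posLog_inv (x := ‖(M z - p) / deriv M z‖)
    rw [← norm_inv, inv_div, norm_div (M z - p), Real.log_div (norm_ne_zero_iff.2 hFz)
      (norm_ne_zero_iff.2 hM'z)] at h7
    have h8 : Real.log ‖deriv M z‖ = (s + 1) * Real.log ‖f z‖ + Real.log ‖H z‖ := by
      rw [hMH z, norm_mul, norm_pow, Real.log_mul
        (pow_ne_zero _ (norm_ne_zero_iff.2 hfz)) (norm_ne_zero_iff.2 hHz), Real.log_pow]
      push_cast
      ring
    rw [← norm_div] at h7
    rw [h2] at h1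
    linarith
  have hne : ∀ z, f z * M z * deriv M z * (M z - p) ≠ 0 → f z ≠ 0 ∧ M z ≠ 0 ∧ deriv M z ≠ 0 ∧
      M z - p ≠ 0 := by
    intro z hz
    exact ⟨left_ne_zero_of_mul (left_ne_zero_of_mul (left_ne_zero_of_mul hz)),
      right_ne_zero_of_mul (left_ne_zero_of_mul (left_ne_zero_of_mul hz)),
      right_ne_zero_of_mul (left_ne_zero_of_mul hz), right_ne_zero_of_mul hz⟩
  have hmono := circleAverage_mono_of_ne_zero
    (G := fun z ↦ f z * M z * deriv M z * (M z - p)) (w := 0)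
    (((hf.mul hM.1).mul hM.1.deriv).mul hF.1) (by simp [hf0, hM0, hM', hMp]) hr0
    (u := fun z ↦ ((s + 1 : ℝ) • Real.posLog ‖f z‖) + Real.log ‖H z‖)
    (v := fun z ↦ (Real.posLog ‖p⁻¹‖ + Real.log 2) + (2 : ℝ) • Real.posLog ‖M z / f z ^ d‖ +
      Real.posLog ‖deriv M z / M z‖ + Real.posLog ‖deriv M z / (M z - p)‖ + Real.log ‖M z - p‖)
    (hfi'.const_fun_smul.add hHi)
    (((((circleIntegrable_const _ _ _).add (hAi r).const_fun_smul).add (hLi r)).add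
      (hTi r)).add hFi)
    (fun z _ hz ↦ by
      obtain ⟨h1, h2, h3, h4⟩ := hne z hz
      have h5 := hpt z h1 h2 h3 h4
      have h6 : (d - (s + 1)) * (Real.log ‖f z‖ - Real.posLog ‖f z‖) ≤ 0 := by
        refine mul_nonpos_of_nonneg_of_nonpos ?_ ?_
        · have : ((s + 2 : ℕ) : ℝ) ≤ d := by exact_mod_cast hed
          push_cast at this
          linarith
        · rw [sub_nonpos]
          exact le_max_right _ _
      simp only [smul_eq_mul]
      linarith)
  have i1 : CircleIntegrable (fun z ↦ (Real.posLog ‖p⁻¹‖ + Real.log 2) +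
      (2 : ℝ) • Real.posLog ‖M z / f z ^ d‖) 0 r :=
    (circleIntegrable_const _ _ _).add (hAi r).const_fun_smul
  have i2 : CircleIntegrable (fun z ↦ (Real.posLog ‖p⁻¹‖ + Real.log 2) +
      (2 : ℝ) • Real.posLog ‖M z / f z ^ d‖ + Real.posLog ‖deriv M z / M z‖) 0 r :=
    i1.add (hLi r)
  have i3 : CircleIntegrable (fun z ↦ (Real.posLog ‖p⁻¹‖ + Real.log 2) +
      (2 : ℝ) • Real.posLog ‖M z / f z ^ d‖ + Real.posLog ‖deriv M z / M z‖ +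
      Real.posLog ‖deriv M z / (M z - p)‖) 0 r :=
    i2.add (hTi r)
  rw [Real.circleAverage_fun_add hfi'.const_fun_smul hHi, Real.circleAverage_fun_smul,
    Real.circleAverage_fun_add i3 hFi, Real.circleAverage_fun_add i2 (hTi r),
    Real.circleAverage_fun_add i1 (hLi r),
    Real.circleAverage_fun_add (circleIntegrable_const _ _ _) (hAi r).const_fun_smul,
    Real.circleAverage_const, Real.circleAverage_fun_smul, smul_eq_mul, smul_eq_mul] at hmono
  change (s + 1) * entireProximity f r + _ ≤ _ at hmono
  have h1 := hAle r R hr hR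
  have h2 := hLle r R hr hR
  have h3 := hTle r R hr hR
  have h4 := hFle r hr
  have h5 := hH.log_norm_zero_le_circleAverage hr0 hH0
  have h6 := neg_abs_le (Real.log ‖H 0‖)
  have h7 : Real.log r ≤ Real.log R := Real.log_le_log hr0 hR.le
  have h8 : 0 ≤ Real.log X := Real.log_nonneg (one_le_growthScale hm hr hR)
  have h9 : 0 ≤ Real.log r := Real.log_nonneg hr
  have h10 := hm r
  have h11 : (0 : ℝ) ≤ s * entireProximity f r := by positivity
  set Z := Real.log R + Real.log X
  have h12 : ∀ a : ℝ, 0 ≤ a → a * (1 + Real.log X) ≤ a * (1 + Real.log R + Real.log X) :=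
    fun a ha ↦ mul_le_mul_of_nonneg_left (by linarith) ha
  have h13 : CF * (1 + Real.log r) ≤ CF * (1 + Real.log R + Real.log X) :=
    mul_le_mul_of_nonneg_left (by linarith) hCF
  have h14 : c ≤ c * (1 + Real.log R + Real.log X) := le_mul_of_one_le_right hc0 (by linarith)
  have := h12 CA hCA
  have := h12 CL hCL
  have := h12 CT hCT
  linarith

/-- The analogue of `entireProximity_le_of_finite` for constant `M`. -/
lemma entireProximity_le_of_const {f : ℂ → ℂ} (hf : Differentiable ℂ f) {d : ℕ} (hd : 0 < d)
    {c : ℂ} (hc : c ≠ 0) (hf0 : ∀ z, f z ≠ 0)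
    (hA : IsGrowthSmall (entireProximity f) (fun z ↦ c / f z ^ d)) :
    ∃ C : ℝ, 0 ≤ C ∧ ∀ r R : ℝ, 1 ≤ r → r < R → entireProximity f r ≤
      C * (1 + Real.log R + Real.log (growthScale (entireProximity f) r R)) := by
  have hm := entireProximity_nonneg f
  have hAi := hA.circleIntegrable
  obtain ⟨-, CA, hCA, hAle⟩ := hA
  have hd1 : (1 : ℝ) ≤ d := by exact_mod_cast hd
  set b : ℝ := Real.posLog ‖c⁻¹‖ + d * |Real.log ‖f 0‖| with hb
  have hb0 : 0 ≤ b := by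
    have := Real.posLog_nonneg (x := ‖c⁻¹‖)
    positivity
  refine ⟨b + CA, by positivity, fun r R hr hR ↦ ?_⟩
  have hr0 : 0 < r := by linarith
  have hfi := circleIntegrable_log_norm_of_differentiable hf r
  have hfi' := circleIntegrable_posLog_norm_of_differentiable hf r
  have hmono := Real.circleAverage_mono (c := 0) (R := r)
    (f₁ := fun z ↦ (d : ℝ) • Real.posLog ‖f z‖)
    (f₂ := fun z ↦ Real.posLog ‖c⁻¹‖ + Real.posLog ‖c / f z ^ d‖ + (d : ℝ) • Real.log ‖f z‖)
    hfi'.const_fun_smul (((circleIntegrable_const _ _ _).add (hAi r)).add hfi.const_fun_smul)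
    (fun z _ ↦ by
      have h1 := mul_posLog_eq d ‖f z‖
      have h2 : ‖f z‖⁻¹ ^ d = ‖c⁻¹‖ * ‖c / f z ^ d‖ := by
        rw [← norm_mul, ← norm_inv, ← norm_pow]
        congr 1
        rw [inv_pow]
        field_simp
      have h3 := Real.posLog_mul (x := ‖c⁻¹‖) (y := ‖c / f z ^ d‖)
      rw [h2] at h1
      simp only [smul_eq_mul]
      linarith)
  have hi : CircleIntegrable (fun z ↦ Real.posLog ‖c⁻¹‖ + Real.posLog ‖c / f z ^ d‖) 0 r :=
    (circleIntegrable_const _ _ _).add (hAi r)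
  rw [Real.circleAverage_fun_smul, Real.circleAverage_fun_add
    hi hfi.const_fun_smul,
    Real.circleAverage_fun_add (circleIntegrable_const _ _ _) (hAi r),
    Real.circleAverage_const, Real.circleAverage_fun_smul, smul_eq_mul, smul_eq_mul,
    circleAverage_log_norm_of_forall_ne_zero hf hf0 hr0] at hmono
  change d * entireProximity f r ≤ _ at hmono
  have h1 := hAle r R hr hR
  have h2 : 0 ≤ Real.log R := Real.log_nonneg (by linarith)
  have h3 := Real.log_nonneg (one_le_growthScale hm hr hR)
  have h4 : entireProximity f r ≤ d * entireProximity f r := le_mul_of_one_le_left (hm r) hd1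
  have h5 : d * Real.log ‖f 0‖ ≤ d * |Real.log ‖f 0‖| :=
    mul_le_mul_of_nonneg_left (le_abs_self _) (by positivity)
  have h6 := le_mul_of_one_le_right hb0
    (by linarith : 1 ≤ 1 + Real.log R + Real.log (growthScale (entireProximity f) r R))
  have h7 : CA * (1 + Real.log (growthScale (entireProximity f) r R)) ≤ CA * (1 + Real.log R +
    Real.log (growthScale (entireProximity f) r R)) := mul_le_mul_of_nonneg_left (by linarith) hCA
  linarith

/-- A Borel type growth lemma. -/
lemma exists_forall_le_mul_log {m : ℝ → ℝ} (hm : ∀ r, 0 ≤ m r)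
    (hbdd : ∀ ρ, ∃ B, ∀ r, 0 ≤ r → r ≤ ρ → m r ≤ B) {C : ℝ} (hC : 0 ≤ C)
    (h : ∀ r R : ℝ, 1 ≤ r → r < R → m r ≤ C * (1 + Real.log R + Real.log (growthScale m r R))) :
    ∃ D ρ : ℝ, 0 ≤ D ∧ 1 ≤ ρ ∧ ∀ r, ρ ≤ r → m r ≤ D * Real.log r := by
  set D : ℝ := 8 * (C + 1) with hD
  have hD1 : 1 ≤ D := by linarith
  refine ⟨D, Real.exp D, by linarith, Real.one_le_exp (by linarith), ?_⟩
  by_contra! hcon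
  obtain ⟨ρ, hρ, hmρ⟩ := hcon
  have hρ1 : 1 ≤ ρ := (Real.one_le_exp (by linarith)).trans hρ
  set L := Real.log ρ with hL
  have hDL : D ≤ L := (Real.le_log_iff_exp_le (by linarith)).2 hρ
  obtain ⟨B, hB⟩ := hbdd (ρ + 1)
  have hpow : ∀ i : ℕ, 0 < (2⁻¹ : ℝ) ^ i := fun i ↦ by positivity
  have key : ∀ i : ℕ, D * (L + i) ≤ m (ρ + 1 - 2⁻¹ ^ i) := by
    intro i
    induction i with
    | zero => simpa using hmρ.le
    | succ i ih =>
      set r := ρ + 1 - 2⁻¹ ^ i with hr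
      set R := ρ + 1 - 2⁻¹ ^ (i + 1) with hR
      have hpi := hpow (i + 1)
      have hpi1 : (2⁻¹ : ℝ) ^ i ≤ 1 := pow_le_one₀ (by norm_num) (by norm_num)
      have hRr : R - r = 2⁻¹ ^ (i + 1) := by
        rw [hR, hr, pow_succ]
        ring
      have hr1 : 1 ≤ r := by linarith
      have hR0 : 0 < R := by linarith
      have h1 := h r R hr1 (by linarith)
      have h2 : Real.log R ≤ 2 * L := by
        calc Real.log R ≤ Real.log (2 * ρ) := Real.log_le_log hR0 (by linarith)
          _ = Real.log 2 + L := Real.log_mul (by norm_num) (by linarith)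
          _ ≤ 2 * L := by linarith [Real.log_two_lt_d9]
      have h3 : Real.log (growthScale m r R) =
          Real.log R + Real.log (1 + m R) + (i + 1) * Real.log 2 := by
        rw [growthScale, hRr, Real.log_div (mul_ne_zero hR0.ne' (by linarith [hm R])) hpi.ne',
          Real.log_mul hR0.ne' (by linarith [hm R]), Real.log_pow, Real.log_inv]
        push_cast
        ring
      set x : ℝ := L + i with hx
      have hi : (0 : ℝ) ≤ i := by positivity
      have hxL : L ≤ x := by linarith
      have h4 : ((i : ℝ) + 1) * Real.log 2 ≤ (i + 1) * 1 :=
        mul_le_mul_of_nonneg_left (by linarith [Real.log_two_lt_d9]) (by positivity)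
      have hl : 0 ≤ Real.log (1 + m R) := Real.log_nonneg (by linarith [hm R])
      have h5 : D * x ≤ C * (6 * x + Real.log (1 + m R)) := by
        refine (ih.trans h1).trans (mul_le_mul_of_nonneg_left ?_ hC)
        rw [h3]
        linarith
      have h6 : 2 * x ≤ Real.log (1 + m R) := by
        by_contra! hlt
        have := mul_le_mul_of_nonneg_left hlt.le hC
        nlinarith
      rw [Real.le_log_iff_exp_le (by linarith [hm R])] at h6
      have h7 := Real.quadratic_le_exp_of_nonneg (by linarith : 0 ≤ 2 * x)
      have h8 : D * x ≤ x * x := mul_le_mul_of_nonneg_right (by linarith) (by linarith)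
      have h9 : D * 1 ≤ D * x := mul_le_mul_of_nonneg_left (by linarith) (by linarith)
      push_cast
      rw [← add_assoc, ← hx]
      nlinarith
  obtain ⟨i, hi⟩ := exists_nat_gt B
  have h1 : (2⁻¹ : ℝ) ^ i ≤ 1 := pow_le_one₀ (by norm_num) (by norm_num)
  have h2 := hB (ρ + 1 - 2⁻¹ ^ i) (by linarith) (by linarith [hpow i])
  have h3 : (1 : ℝ) * (L + i) ≤ D * (L + i) :=
    mul_le_mul_of_nonneg_right hD1 (by have : (0 : ℝ) ≤ i := by positivity
                                       linarith)
  linarith [key i]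

lemma exists_polynomial_of_entireProximity_le_log {f : ℂ → ℂ} (hf : Differentiable ℂ f)
    {D ρ : ℝ} (hD : 0 ≤ D) (hρ : 1 ≤ ρ) (h : ∀ r, ρ ≤ r → entireProximity f r ≤ D * Real.log r) :
    ∃ P : Polynomial ℂ, ∀ z, f z = P.eval z := by
  obtain ⟨k, hk⟩ := exists_nat_ge (3 * D)
  refine exists_polynomial_of_norm_le_pow hf k ((2 + ρ) ^ k) fun w ↦ ?_
  have hw := norm_nonneg w
  have h1 := hf.posLog_norm_le (w := w) (R := 2 * ‖w‖ + ρ) (by linarith)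
  have h2 : (2 * ‖w‖ + ρ + ‖w‖) / (2 * ‖w‖ + ρ - ‖w‖) ≤ 3 := by
    rw [div_le_iff₀ (by linarith)]
    linarith
  have hx : 1 ≤ (2 + ρ) * (1 + ‖w‖) := by nlinarith
  have h3 : Real.log (2 * ‖w‖ + ρ) ≤ Real.log ((2 + ρ) * (1 + ‖w‖)) :=
    Real.log_le_log (by linarith) (by nlinarith)
  have h4 : Real.posLog ‖f w‖ ≤ k * Real.log ((2 + ρ) * (1 + ‖w‖)) := by
    calc Real.posLog ‖f w‖ ≤ 3 * entireProximity f (2 * ‖w‖ + ρ) :=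
          h1.trans (mul_le_mul_of_nonneg_right h2 (entireProximity_nonneg f _))
      _ ≤ 3 * (D * Real.log (2 * ‖w‖ + ρ)) := by linarith [h (2 * ‖w‖ + ρ) (by linarith)]
      _ ≤ 3 * (D * Real.log ((2 + ρ) * (1 + ‖w‖))) := by gcongr
      _ = 3 * D * Real.log ((2 + ρ) * (1 + ‖w‖)) := by ring
      _ ≤ _ := mul_le_mul_of_nonneg_right hk (Real.log_nonneg hx)
  rw [← mul_pow]
  calc ‖f w‖ ≤ Real.exp (Real.log ‖f w‖) := Real.le_exp_log _
    _ ≤ Real.exp (k * Real.log ((2 + ρ) * (1 + ‖w‖))) :=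
        Real.exp_le_exp.2 ((le_max_right _ _).trans h4)
    _ = _ := by rw [Real.exp_nat_mul, Real.exp_log (by linarith)]

lemma exists_polynomial_of_entireProximity_le {f : ℂ → ℂ} (hf : Differentiable ℂ f)
    (h : ∃ C : ℝ, 0 ≤ C ∧ ∀ r R : ℝ, 1 ≤ r → r < R → entireProximity f r ≤
      C * (1 + Real.log R + Real.log (growthScale (entireProximity f) r R))) :
    ∃ P : Polynomial ℂ, ∀ z, f z = P.eval z := by
  obtain ⟨C, hC, h⟩ := h
  have hbdd : ∀ ρ, ∃ B, ∀ r, 0 ≤ r → r ≤ ρ → entireProximity f r ≤ B := by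
    intro ρ
    obtain ⟨B, hB⟩ := (isCompact_closedBall (0 : ℂ) ρ).exists_bound_of_continuousOn
      hf.continuous.continuousOn
    refine ⟨Real.posLog B, fun r hr0 hr ↦ Real.circleAverage_mono_on_of_le_circle
      (circleIntegrable_posLog_norm_of_differentiable hf r) fun z hz ↦
      Real.posLog_le_posLog (norm_nonneg _) (hB z ?_)⟩
    simp only [mem_sphere_iff_norm, sub_zero, abs_of_nonneg hr0] at hz
    simpa [hz] using hr
  obtain ⟨D, ρ, hD, hρ, hlog⟩ :=
    exists_forall_le_mul_log (entireProximity_nonneg f) hbdd hC h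
  exact exists_polynomial_of_entireProximity_le_log hf hD hρ hlog

lemma Differentiable.diffMonomial {f : ℂ → ℂ} (hf : Differentiable ℂ f) (n k : ℕ)
    (nn tt : Fin k → ℕ) : Differentiable ℂ (diffMonomial n k nn tt f) :=
  (hf.pow n).mul (Differentiable.fun_finsetProd fun j _ ↦
    (hf.pow (nn j)).iteratedDeriv_complex (tt j))

lemma diffMonomial_comp_add_const (n k : ℕ) (nn tt : Fin k → ℕ) (f : ℂ → ℂ) (a : ℂ) :
    diffMonomial n k nn tt (fun z ↦ f (z + a)) = fun z ↦ diffMonomial n k nn tt f (z + a) := by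
  funext z
  simp only [diffMonomial]
  congr 1
  refine Finset.prod_congr rfl fun j _ ↦ ?_
  exact congrFun (iteratedDeriv_comp_add_const (tt j) (fun w ↦ f w ^ nn j) a) z

lemma exists_diffMonomial_eq {f : ℂ → ℂ} (hf : Differentiable ℂ f) (n k : ℕ)
    {nn tt : Fin k → ℕ} (hjt : ∀ j, tt j ≤ nn j) : ∃ Q : ℂ → ℂ, Differentiable ℂ Q ∧
      ∀ z, diffMonomial n k nn tt f z = f z ^ (n + ∑ j, (nn j - tt j)) * Q z := by
  choose q hq hqe using fun j ↦ exists_iteratedDeriv_pow_eq hf (hjt j)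
  refine ⟨fun z ↦ ∏ j, q j z, Differentiable.fun_finsetProd fun j _ ↦ hq j, fun z ↦ ?_⟩
  rw [diffMonomial, Finset.prod_congr rfl fun j _ ↦ hqe j z, Finset.prod_mul_distrib,
    Finset.prod_pow_eq_pow_sum, pow_add, mul_assoc]

/-- The main theorem under the assumption that the origin is a generic point. -/
lemma exists_polynomial_of_diffMonomial_finite {f : ℂ → ℂ} (hf : Differentiable ℂ f) {n k : ℕ}
    {nn tt : Fin k → ℕ} (hjt : ∀ j, tt j ≤ nn j)
    (hsum : 2 + ∑ j : Fin k, tt j ≤ n + ∑ j : Fin k, nn j) {p : ℂ} (hp : p ≠ 0)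
    (hfin : {z : ℂ | diffMonomial n k nn tt f z = p}.Finite) (hf0 : f 0 ≠ 0)
    (hfj : ∀ j, ∀ i ≤ tt j, iteratedDeriv i (fun w ↦ f w ^ nn j) 0 ≠ 0)
    (hMp : diffMonomial n k nn tt f 0 ≠ p)
    (hM' : (∃ z, deriv (diffMonomial n k nn tt f) z ≠ 0) →
      deriv (diffMonomial n k nn tt f) 0 ≠ 0) :
    ∃ P : Polynomial ℂ, ∀ z, f z = P.eval z := by
  refine exists_polynomial_of_entireProximity_le hf ?_
  have hm := entireProximity_nonneg f
  have hfd := hf.isGrowthDominated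
  have hd := hf.diffMonomial n k nn tt
  obtain ⟨Q, hQ, hMQ⟩ := exists_diffMonomial_eq hf n k hjt
  have hM0 : diffMonomial n k nn tt f 0 ≠ 0 :=
    mul_ne_zero (pow_ne_zero _ hf0) (Finset.prod_ne_zero_iff.2 fun j _ ↦ hfj j _ le_rfl)
  have hsum' : ∑ j, (nn j - tt j) + ∑ j, tt j = ∑ j, nn j := by
    rw [← Finset.sum_add_distrib]
    exact Finset.sum_congr rfl fun j _ ↦ Nat.sub_add_cancel (hjt j)
  have hM : IsGrowthDominated (entireProximity f) (diffMonomial n k nn tt f) :=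
    (hfd.pow hm n).mul hm (IsGrowthDominated.prod hm _ fun j _ ↦
      (hfd.pow hm (nn j)).iteratedDeriv hm (tt j))
  have hA : IsGrowthSmall (entireProximity f)
      (fun z ↦ diffMonomial n k nn tt f z / f z ^ (n + ∑ j, nn j)) := by
    refine (IsGrowthSmall.prod hm Finset.univ fun j _ ↦
      isGrowthSmall_iteratedDeriv_div hm (hfd.pow hm (nn j)) (hfj j)).congr_of_ne_zero
      (fun z _ ↦ (hd.analyticAt z).meromorphicAt.fun_div
        ((hf.pow _).analyticAt z).meromorphicAt) hf hf0 fun z hz ↦ ?_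
    rw [Finset.prod_div_distrib, Finset.prod_pow_eq_pow_sum, diffMonomial, pow_add,
      mul_div_mul_left _ _ (pow_ne_zero n hz)]
  by_cases hc : ∃ z, deriv (diffMonomial n k nn tt f) z ≠ 0
  · exact entireProximity_le_of_finite hf hQ (by omega) (by omega) hp hM hMQ hf0 hM0
      (sub_ne_zero.2 hMp) (hM' hc) hA hfin
  · push Not at hc
    have hconst : ∀ z, diffMonomial n k nn tt f z = diffMonomial n k nn tt f 0 :=
      fun z ↦ is_const_of_deriv_eq_zero hd hc z 0
    refine entireProximity_le_of_const hf (d := n + ∑ j, nn j) (by omega) hM0 (fun z hz ↦ ?_)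
      (by simpa only [hconst] using hA)
    rw [← hconst z, hMQ, hz, zero_pow (by omega), zero_mul] at hM0
    exact hM0 rfl

/-- Lemma: if `f` is a transcendental entire function (entire but not a polynomial),
`n_j ≥ t_j` and `n + Σ n_j ≥ 2 + Σ t_j`, then `M[f]` assumes every non-zero value `p`
infinitely often. -/
theorem transcendental_entire_monomial_infinitely_often
    (f : ℂ → ℂ) (hf : Differentiable ℂ f)
    (htrans : ¬ ∃ P : Polynomial ℂ, ∀ z : ℂ, f z = P.eval z)
    (n k : ℕ) (hk : 0 < k) (nn tt : Fin k → ℕ)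
    (hnn : ∀ j, 0 < nn j) (htt : ∀ j, 0 < tt j)
    (hjt : ∀ j, tt j ≤ nn j)
    (hsum : 2 + ∑ j : Fin k, tt j ≤ n + ∑ j : Fin k, nn j)
    (p : ℂ) (hp : p ≠ 0) :
    {z : ℂ | diffMonomial n k nn tt f z = p}.Infinite := by
  intro hfin
  have hd := hf.diffMonomial n k nn tt
  obtain ⟨w, hw⟩ : ∃ z, f z ≠ 0 := by
    by_contra! h
    exact htrans ⟨0, by simpa using h⟩
  obtain ⟨v, hv⟩ := hfin.infinite_compl.nonempty
  have hev : ∀ᶠ a in nhdsWithin (0 : ℂ) {0}ᶜ, f a ≠ 0 ∧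
      (∀ j, ∀ i ≤ tt j, iteratedDeriv i (fun w ↦ f w ^ nn j) a ≠ 0) ∧
      diffMonomial n k nn tt f a - p ≠ 0 ∧
      ((∃ z, deriv (diffMonomial n k nn tt f) z ≠ 0) →
        deriv (diffMonomial n k nn tt f) a ≠ 0) := by
    refine (hf.eventually_ne_zero_nhdsNE hw 0).and (.and ?_ (.and ?_ ?_))
    · refine Filter.eventually_all.2 fun j ↦
        (Filter.eventually_all_finite (Set.finite_Iic (tt j))).2 fun i _ ↦ ?_
      obtain ⟨z, hz⟩ := exists_iteratedDeriv_pow_ne_zero hf htrans (hnn j) i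
      exact ((hf.pow (nn j)).iteratedDeriv_complex i).eventually_ne_zero_nhdsNE hz 0
    · exact (hd.sub_const p).eventually_ne_zero_nhdsNE (w := v) (sub_ne_zero.2 hv) 0
    · refine Filter.eventually_imp_distrib_left.2 fun ⟨z, hz⟩ ↦ ?_
      exact hd.deriv.eventually_ne_zero_nhdsNE hz 0
  obtain ⟨a, ha0, haj, hap, ha'⟩ := hev.exists
  have hM := diffMonomial_comp_add_const n k nn tt f a
  have hM' : ∀ z, deriv (fun z ↦ diffMonomial n k nn tt f (z + a)) z =
      deriv (diffMonomial n k nn tt f) (z + a) := fun z ↦ deriv_comp_add_const _ a z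
  obtain ⟨P, hP⟩ := exists_polynomial_of_diffMonomial_finite (f := fun z ↦ f (z + a))
    (hf.comp (differentiable_id.add_const a)) hjt hsum hp
    (by
      rw [hM]
      exact hfin.preimage (add_left_injective a).injOn)
    (by simpa using ha0)
    (fun j i hi ↦ by
      have := congrFun (iteratedDeriv_comp_add_const i (fun w ↦ f w ^ nn j) a) 0
      rw [this]
      simpa using haj j i hi)
    (by
      rw [hM]
      simpa [sub_ne_zero] using hap)
    (by
      rw [hM]
      rintro ⟨z, hz⟩
      rw [hM', zero_add]
      exact ha' ⟨z + a, by rwa [← hM' z]⟩)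
  refine htrans ⟨P.comp (Polynomial.X - Polynomial.C a), fun z ↦ ?_⟩
  simpa using hP (z - a)
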